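/- Let r, s ≥ 1. For all a ∈ C outside some countable subset of C, the algebra A_{r,s,a} equals the algebra of all polynomials f(x; y_1,...,y_r; z_1,...,z_s) that are symmetric separately in the y-variables and in the z-variables and satisfy the following quasi-invariance conditions: (1) f(x; y_1,...,y_{r−1},u; z_1,...,z_{s−1},u) = f(u; y_1,...,y_{r−1},x; z_1,...,z_{s−1},x) identically in x, u and the remaining variables; (2) ((∂_{y_r} − a∂_{z_s})f)(x; y_1,...,y_{r−1},u; z_1,...,z_{s−1},u) = 0; (3) (((a+1)∂_{y_r} − a∂_x)f)(x; y_1,...,y_{r−1},x; z_1,...,z_s) = 0; (4) (((a+1)∂_{z_s} − ∂_x)f)(x; y_1,...,y_r; z_1,...,z_{s−1},x) = 0. -/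

import Mathlib

open MvPolynomial

set_option synthInstance.maxHeartbeats 1000000
set_option maxHeartbeats 1000000

noncomputable section

/-- The polynomial ring `ℂ[x, y_1,...,y_r, z_1,...,z_s]`, with `x = X (inl ())`,
`y_j = X (inr (inl j))`, `z_l = X (inr (inr l))`. -/
abbrev Rxrs (r s : ℕ) := MvPolynomial (Unit ⊕ Fin r ⊕ Fin s) ℂ

/-- The generating polynomial `P_i = (a+1)x^i + a(y_1^i + ... + y_r^i) + z_1^i+...+z_s^i`. -/
def Pa (r s : ℕ) (a : ℂ) (i : ℕ) : Rxrs r s :=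
  C (a + 1) * X (Sum.inl ()) ^ i + C a * ∑ j : Fin r, X (Sum.inr (Sum.inl j)) ^ i +
    ∑ l : Fin s, X (Sum.inr (Sum.inr l)) ^ i

/-- The algebra `A_{r,s,a}` generated by the `P_i`, `i ≥ 1`. -/
def Ars (r s : ℕ) (a : ℂ) : Subalgebra ℂ (Rxrs r s) :=
  Algebra.adjoin ℂ {f : Rxrs r s | ∃ i : ℕ, 1 ≤ i ∧ f = Pa r s a i}

/-- The evaluation of a polynomial at the point `(x; y_1,...,y_r; z_1,...,z_s)`. -/
def evP (r s : ℕ) (xv : ℂ) (yv : Fin r → ℂ) (zv : Fin s → ℂ) (f : Rxrs r s) : ℂ :=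
  eval (Sum.elim (fun _ : Unit => xv) (Sum.elim yv zv)) f

namespace QuasiInvariants

/-- A map `ℂ → W` given by a polynomial with coefficients in the vector space `W`. -/
def IsPolyCurve {W : Type*} [AddCommGroup W] [Module ℂ W] (c : ℂ → W) : Prop :=
  ∃ (n : ℕ) (w : ℕ → W), ∀ a, c a = ∑ k ∈ Finset.range n, a ^ k • w k

lemma IsPolyCurve.exists_eval_eq {W : Type*} [AddCommGroup W] [Module ℂ W] {c : ℂ → W}
    (hc : IsPolyCurve c) (φ : W →ₗ[ℂ] ℂ) : ∃ p : Polynomial ℂ, ∀ a, p.eval a = φ (c a) := by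
  obtain ⟨n, w, h⟩ := hc
  refine ⟨∑ k ∈ Finset.range n, Polynomial.X ^ k * Polynomial.C (φ (w k)), fun a => ?_⟩
  simp only [h, Polynomial.eval_finsetSum, map_sum, map_smul, smul_eq_mul, Polynomial.eval_mul,
    Polynomial.eval_pow, Polynomial.eval_X, Polynomial.eval_C]

lemma isPolyCurve_add_smul {W : Type*} [AddCommGroup W] [Module ℂ W] (u v : W) :
    IsPolyCurve fun a : ℂ => u + a • v :=
  ⟨2, fun k => if k = 0 then u else v, fun a => by simp [Finset.sum_range_succ]⟩

lemma isPolyCurve_const {W : Type*} [AddCommGroup W] [Module ℂ W] (u : W) :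
    IsPolyCurve fun _ : ℂ => u :=
  ⟨1, fun _ => u, fun a => by simp⟩

/-- Linear independence at `0` of finitely many polynomial curves spreads out. -/
lemma finite_not_linearIndependent {W ι : Type*} [AddCommGroup W] [Module ℂ W] [Finite ι]
    (v : ι → ℂ → W) (hv : ∀ i, IsPolyCurve (v i))
    (h0 : LinearIndependent ℂ fun i => v i 0) :
    {a : ℂ | ¬ LinearIndependent ℂ fun i => v i a}.Finite := by
  classical
  have := Fintype.ofFinite ι
  obtain ⟨g, hg⟩ := LinearMap.exists_leftInverse_of_injective
    (Finsupp.linearCombination ℂ fun i => v i 0) (LinearMap.ker_eq_bot.2 h0)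
  have hgv : ∀ i j, g (v j 0) i = if i = j then 1 else 0 := by
    intro i j
    have := congrArg (fun l => l (Finsupp.single j (1 : ℂ)) i) hg
    simpa [Finsupp.single_apply, eq_comm] using this
  choose p hp using fun i j => (hv j).exists_eval_eq (Finsupp.lapply i ∘ₗ g)
  let M : Matrix ι ι (Polynomial ℂ) := Matrix.of p
  have hM : ∀ a, M.det.eval a = (Matrix.of fun i j => g (v j a) i).det := by
    intro a
    rw [← Polynomial.coe_evalRingHom, RingHom.map_det]
    congr 1
    ext i j
    simp [M, hp]
  have hne : M.det ≠ 0 := by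
    intro h
    have := hM 0
    rw [h, show (Matrix.of fun i j => g (v j 0) i) = (1 : Matrix ι ι ℂ) from by
      ext i j; simp [hgv, Matrix.one_apply]] at this
    simp at this
  refine (M.det.rootSet_finite ℂ).subset fun a ha => ?_
  rw [Polynomial.mem_rootSet]
  refine ⟨hne, ?_⟩
  by_contra hdet
  refine ha ?_
  rw [Polynomial.coe_aeval_eq_eval, hM] at hdet
  have := Matrix.linearIndependent_cols_of_det_ne_zero hdet
  have h2 : LinearIndependent ℂ fun j => (Finsupp.lcoeFun ∘ₗ g) (v j a) := by
    exact this
  exact LinearIndependent.of_comp _ h2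

/-- Semicontinuity: if every vector of `V` killed by `L₀` is the value at `0` of a polynomial curve
in `A a ∩ V`, where `A a` is killed by `L₀ + a L₁`, then for all but countably many `a` the vectors
of `V` killed by `L₀ + a L₁` lie in `A a`. -/
lemma exists_countable_ker_le {R W : Type*} [AddCommGroup R] [Module ℂ R] [AddCommGroup W]
    [Module ℂ W] (V : Submodule ℂ R) [FiniteDimensional ℂ V] (L₀ L₁ : R →ₗ[ℂ] W)
    (A : ℂ → Submodule ℂ R) (hA : ∀ a, ∀ f ∈ A a, L₀ f + a • L₁ f = 0)
    (hlift : ∀ v ∈ V, L₀ v = 0 → ∃ c : ℂ → R, IsPolyCurve c ∧ c 0 = v ∧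
      ∀ a ≠ 0, c a ∈ A a ∧ c a ∈ V) :
    ∃ E : Set ℂ, E.Countable ∧ ∀ a ∉ E, ∀ f ∈ V, L₀ f + a • L₁ f = 0 → f ∈ A a := by
  let N : Submodule ℂ V := LinearMap.ker (L₀ ∘ₗ V.subtype)
  obtain ⟨U, hU⟩ := N.exists_isCompl
  let bN := Module.finBasis ℂ N
  let bU := Module.finBasis ℂ U
  choose c hc hc0 hcA using fun i => hlift ((bN i : V) : R) (bN i : V).2 (by
    exact LinearMap.mem_ker.1 (bN i).2)
  let cu : Fin (Module.finrank ℂ U) → R := fun j => ((bU j : V) : R)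
  have hindep0 : LinearIndependent ℂ (Sum.elim (fun i => c i 0) cu) := by
    have h1 : LinearIndependent ℂ (Sum.elim (fun i => (bN i : V)) (fun j => (bU j : V))) := by
      refine LinearIndependent.sum_type
        (bN.linearIndependent.map' N.subtype (Submodule.ker_subtype _))
        (bU.linearIndependent.map' U.subtype (Submodule.ker_subtype _)) ?_
      refine hU.disjoint.mono ?_ ?_ <;>
      · rw [Submodule.span_le]; rintro _ ⟨i, rfl⟩; simp
    have h2 := h1.map' V.subtype (Submodule.ker_subtype _)
    have e : Sum.elim (fun i => c i 0) cu =
        V.subtype ∘ Sum.elim (fun i => (bN i : V)) (fun j => (bU j : V)) := by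
      ext x
      rcases x with i | j
      · simp [hc0]
      · simp [cu]
    rw [e]
    exact h2
  have hE1 := finite_not_linearIndependent
    (fun x a => Sum.elim (fun i => c i a) cu x) (by
      rintro (i | j)
      · exact hc i
      · exact isPolyCurve_const _) (by convert hindep0 using 1)
  have hE2 := finite_not_linearIndependent (fun j a => L₀ (cu j) + a • L₁ (cu j))
    (fun j => isPolyCurve_add_smul _ _) (by
      have h3 := bU.linearIndependent.map' (L₀ ∘ₗ V.subtype ∘ₗ U.subtype) (by
        rw [LinearMap.ker_eq_bot']
        intro m hm
        have : (m : V) ∈ N ⊓ U := ⟨by simpa [N] using hm, m.2⟩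
        rw [hU.inf_eq_bot] at this
        simpa using this)
      simpa [cu, Function.comp_def] using h3)
  refine ⟨_, ((hE1.union hE2).union (Set.finite_singleton (0 : ℂ))).countable,
    fun a ha f hf hLf => ?_⟩
  simp only [Set.mem_union, Set.mem_ofPred_eq, Set.mem_singleton_iff, not_or, not_not] at ha
  obtain ⟨⟨h1, h2⟩, ha0⟩ := ha
  let b : Fin (Module.finrank ℂ N) ⊕ Fin (Module.finrank ℂ U) → V :=
    Sum.elim (fun i => ⟨c i a, (hcA i a ha0).2⟩) (fun j => (bU j : V))
  have hb : LinearIndependent ℂ b := by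
    refine LinearIndependent.of_comp V.subtype ?_
    convert h1 using 1
    ext x
    rcases x with i | j <;> simp [b, cu]
  have hspan : Submodule.span ℂ (Set.range b) = ⊤ := by
    refine hb.span_eq_top_of_card_eq_finrank' ?_
    simp [Submodule.finrank_add_eq_of_isCompl hU]
  have hmem : (⟨f, hf⟩ : V) ∈ Submodule.span ℂ (Set.range b) := hspan ▸ Submodule.mem_top
  obtain ⟨t, ht⟩ := (Submodule.mem_span_range_iff_exists_fun ℂ).1 hmem
  have ht' : f = ∑ i, t (Sum.inl i) • c i a + ∑ j, t (Sum.inr j) • cu j := by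
    have := congrArg V.subtype ht
    simpa [b, cu] using this.symm
  have hL : ∑ j, t (Sum.inr j) • (L₀ (cu j) + a • L₁ (cu j)) = 0 := by
    have e1 : ∑ i, t (Sum.inl i) • (L₀ (c i a) + a • L₁ (c i a)) = 0 :=
      Finset.sum_eq_zero fun i _ => by rw [hA a _ (hcA i a ha0).1, smul_zero]
    have e2 : L₀ f + a • L₁ f = ∑ i, t (Sum.inl i) • (L₀ (c i a) + a • L₁ (c i a)) +
        ∑ j, t (Sum.inr j) • (L₀ (cu j) + a • L₁ (cu j)) := by
      have : ∀ g, L₀ g + a • L₁ g = (L₀ + a • L₁) g := fun g => by simp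
      simp only [this]
      rw [ht']
      simp only [map_add, map_sum, map_smul]
    rw [hLf, e1, zero_add] at e2
    exact e2.symm
  have ht0 := Fintype.linearIndependent_iff.1 h2 _ hL
  rw [ht']
  simp only [ht0, zero_smul, Finset.sum_const_zero, add_zero]
  exact Submodule.sum_mem _ fun i _ => Submodule.smul_mem _ _ (hcA i a ha0).1

section Expansion

variable {A : Type*} [CommRing A]

lemma exists_expansion {e : ℕ → Polynomial A} (he : ∀ n, (e n).Monic)
    (hd : ∀ n, (e n).natDegree = n) (n : ℕ) (g : Polynomial A) (hg : g.degree < n) :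
    ∃ c : ℕ → A, g = ∑ k ∈ Finset.range n, Polynomial.C (c k) * e k := by
  induction n generalizing g with
  | zero => exact ⟨0, by simpa [Polynomial.degree_lt_iff_coeff_zero, Polynomial.ext_iff] using hg⟩
  | succ n ih =>
    obtain ⟨c, hc⟩ := ih (g - Polynomial.C (g.coeff n) * e n) (by
      rw [Polynomial.degree_lt_iff_coeff_zero] at hg ⊢
      intro m hm
      rcases hm.eq_or_lt with rfl | hlt
      · have := (he n).coeff_natDegree
        rw [hd] at this
        simp [this]
      · have h1 := hg m hlt
        have h2 : (e n).coeff m = 0 :=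
          Polynomial.coeff_eq_zero_of_natDegree_lt (by rw [hd]; exact hlt)
        simp [h1, h2])
    refine ⟨fun k => if k = n then g.coeff n else c k, ?_⟩
    rw [Finset.sum_range_succ]
    simp only [if_true]
    have : ∑ k ∈ Finset.range n, Polynomial.C (if k = n then g.coeff n else c k) * e k =
        ∑ k ∈ Finset.range n, Polynomial.C (c k) * e k :=
      Finset.sum_congr rfl fun k hk => by rw [if_neg (Finset.mem_range.1 hk).ne]
    rw [this, ← hc]
    ring

lemma expansion_unique {e : ℕ → Polynomial A} (he : ∀ n, (e n).Monic)
    (hd : ∀ n, (e n).natDegree = n) (n : ℕ) (c : ℕ → A)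
    (h : ∑ k ∈ Finset.range n, Polynomial.C (c k) * e k = 0) : ∀ k < n, c k = 0 := by
  induction n with
  | zero => intro k hk; omega
  | succ n ih =>
    have hn : c n = 0 := by
      have h1 := congrArg (fun p => Polynomial.coeff p n) h
      simp only [Finset.sum_range_succ, Polynomial.coeff_add, Polynomial.finsetSum_coeff,
        Polynomial.coeff_C_mul, Polynomial.coeff_zero] at h1
      have h2 := (he n).coeff_natDegree
      rw [hd] at h2
      rw [Finset.sum_eq_zero, h2, zero_add, mul_one] at h1
      · exact h1
      · intro k hk
        rw [Polynomial.coeff_eq_zero_of_natDegree_lt (by rw [hd]; exact Finset.mem_range.1 hk),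
          mul_zero]
    intro k hk
    rcases (Nat.lt_succ_iff.1 hk).eq_or_lt with rfl | hlt
    · exact hn
    · refine ih ?_ k hlt
      rwa [Finset.sum_range_succ, hn, map_zero, zero_mul, add_zero] at h

end Expansion

lemma X_sub_C_dvd_iff {ι : Type*} (g : Polynomial (MvPolynomial ι ℂ)) (a : ι) :
    Polynomial.X - Polynomial.C (X a) ∣ g ↔ g.eval (X a) = 0 :=
  Polynomial.dvd_iff_isRoot

lemma pairwise_isRelPrime_X_sub_C {ι : Type*} (n : ℕ) :
    Pairwise (Function.onFun IsRelPrime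
      fun i : ι => (Polynomial.X - Polynomial.C (X i : MvPolynomial ι ℂ)) ^ n) := by
  intro i j hij
  refine IsRelPrime.pow ?_
  have hi : Irreducible (Polynomial.X - Polynomial.C (X i : MvPolynomial ι ℂ)) :=
    Polynomial.irreducible_X_sub_C _
  rw [hi.isRelPrime_iff_not_dvd, Polynomial.dvd_iff_isRoot]
  simp [sub_eq_zero, hij]

variable {ι : Type*} [Fintype ι]

/-- The polynomial `∏ (t - x_i)` over the ring `ℂ[x_i]`. -/
noncomputable def rootPoly (ι : Type*) [Fintype ι] : Polynomial (MvPolynomial ι ℂ) :=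
  ∏ i : ι, (Polynomial.X - Polynomial.C (X i))

/-- The signed elementary symmetric polynomials, i.e. the coefficients of `∏ (1 - x_i t)`. -/
noncomputable def signedEsymm (ι : Type*) [Fintype ι] (n : ℕ) : MvPolynomial ι ℂ :=
  (-1) ^ n * esymm ι ℂ n

/-- A polynomial in `t` whose coefficients are symmetric polynomials in the `x_i`. -/
def HasSymmCoeffs (g : Polynomial (MvPolynomial ι ℂ)) : Prop :=
  ∀ τ : Equiv.Perm ι, g.map (rename τ : MvPolynomial ι ℂ →ₐ[ℂ] MvPolynomial ι ℂ).toRingHom = g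

lemma signedEsymm_eq_zero {n : ℕ} (hn : Fintype.card ι < n) : signedEsymm ι n = 0 := by
  rw [signedEsymm, esymm, Finset.powersetCard_eq_empty.2 (by simpa using hn)]
  simp

lemma signedEsymm_zero : signedEsymm ι 0 = 1 := by simp [signedEsymm]

lemma rename_signedEsymm (τ : Equiv.Perm ι) (n : ℕ) :
    rename τ (signedEsymm ι n) = signedEsymm ι n := by
  simp [signedEsymm, esymm_isSymmetric ι ℂ n τ]

lemma rootPoly_eq_sum : rootPoly ι = ∑ j ∈ Finset.range (Fintype.card ι + 1),
    Polynomial.C (signedEsymm ι j) * Polynomial.X ^ (Fintype.card ι - j) := by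
  have := Multiset.prod_X_sub_X_eq_sum_esymm
    ((Finset.univ : Finset ι).val.map (X : ι → MvPolynomial ι ℂ))
  simp only [Multiset.map_map, Function.comp_def, Multiset.card_map, Finset.card_val,
    Finset.card_univ] at this
  rw [rootPoly]
  refine Eq.trans ?_ (this.trans ?_)
  · rfl
  · refine Finset.sum_congr rfl fun j _ => ?_
    rw [signedEsymm, esymm_eq_multiset_esymm]
    simp [mul_assoc]

lemma rootPoly_monic : (rootPoly ι).Monic :=
  Polynomial.monic_prod_of_monic _ _ fun _ _ => Polynomial.monic_X_sub_C _

lemma rootPoly_natDegree : (rootPoly ι).natDegree = Fintype.card ι := by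
  rw [rootPoly, Polynomial.natDegree_prod_of_monic _ _ fun i _ => Polynomial.monic_X_sub_C _]
  simp

lemma rootPoly_hasSymmCoeffs : HasSymmCoeffs (rootPoly ι) := by
  intro τ
  simp only [rootPoly_eq_sum, Polynomial.map_sum, Polynomial.map_mul, Polynomial.map_C,
    Polynomial.map_pow, Polynomial.map_X]
  refine Finset.sum_congr rfl fun j _ => ?_
  congr 2
  exact rename_signedEsymm τ j

lemma rootPoly_eval (a : ι) : (rootPoly ι).eval (X a) = 0 := by
  rw [rootPoly, Polynomial.eval_prod]
  exact Finset.prod_eq_zero (Finset.mem_univ a) (by simp)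

lemma rootPoly_dvd {g : Polynomial (MvPolynomial ι ℂ)} (h : ∀ a : ι, g.eval (X a) = 0) :
    rootPoly ι ∣ g := by
  refine Finset.prod_dvd_of_isRelPrime ?_ fun i _ => (X_sub_C_dvd_iff g i).2 (h i)
  have := pairwise_isRelPrime_X_sub_C (ι := ι) 1
  simp only [pow_one] at this
  exact this.set_pairwise _

lemma rootPoly_sq_dvd {g : Polynomial (MvPolynomial ι ℂ)} (h : ∀ a : ι, g.eval (X a) = 0)
    (h' : rootPoly ι ∣ Polynomial.derivative g) : rootPoly ι ^ 2 ∣ g := by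
  rw [rootPoly, ← Finset.prod_pow]
  refine Finset.prod_dvd_of_isRelPrime ((pairwise_isRelPrime_X_sub_C 2).set_pairwise _)
    fun a _ => ?_
  obtain ⟨q, rfl⟩ := (X_sub_C_dvd_iff g a).2 (h a)
  have h1 : (Polynomial.derivative ((Polynomial.X - Polynomial.C (X a)) * q)).eval (X a) = 0 := by
    obtain ⟨u, hu⟩ := h'
    rw [hu, Polynomial.eval_mul, rootPoly_eval, zero_mul]
  simp only [Polynomial.derivative_mul, Polynomial.derivative_sub, Polynomial.derivative_X,
    Polynomial.derivative_C, sub_zero, one_mul, Polynomial.eval_add, Polynomial.eval_mul,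
    Polynomial.eval_sub, Polynomial.eval_X, Polynomial.eval_C, sub_self, zero_mul, add_zero] at h1
  rw [sq]
  exact mul_dvd_mul_left _ ((X_sub_C_dvd_iff q a).2 h1)

/-- The antiderivative of `t^(n - N - 1) ∏ (t - x_i)`, where `N` is the number of the `x_i`. -/
noncomputable def rootPrimitive (ι : Type*) [Fintype ι] (n : ℕ) : Polynomial (MvPolynomial ι ℂ) :=
  ∑ j ∈ Finset.range n,
    Polynomial.C (signedEsymm ι j * C (1 / ((n - j : ℕ) : ℂ))) * Polynomial.X ^ (n - j)

lemma derivative_rootPrimitive {n : ℕ} (hn : Fintype.card ι < n) :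
    Polynomial.derivative (rootPrimitive ι n) =
      Polynomial.X ^ (n - Fintype.card ι - 1) * rootPoly ι := by
  rw [rootPrimitive, rootPoly_eq_sum, Polynomial.derivative_sum, Finset.mul_sum]
  have hsub : Finset.range (Fintype.card ι + 1) ⊆ Finset.range n :=
    Finset.range_subset_range.2 hn
  symm
  rw [← Finset.sum_subset hsub]
  · refine Finset.sum_congr rfl fun j hj => ?_
    rw [Finset.mem_range] at hj
    rw [Polynomial.derivative_C_mul, Polynomial.derivative_X_pow]
    have hne : ((n - j : ℕ) : ℂ) ≠ 0 := Nat.cast_ne_zero.2 (by omega)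
    have h1 : Polynomial.C (C (1 / ((n - j : ℕ) : ℂ)) : MvPolynomial ι ℂ) *
        Polynomial.C ((n - j : ℕ) : MvPolynomial ι ℂ) = 1 := by
      rw [← Polynomial.C_mul, ← map_natCast (C : ℂ →+* MvPolynomial ι ℂ), ← C_mul,
        one_div_mul_cancel hne, map_one, map_one]
    rw [Polynomial.C_mul]
    have h2 : n - j - 1 = (n - Fintype.card ι - 1) + (Fintype.card ι - j) := by omega
    rw [h2, pow_add]
    linear_combination (-(Polynomial.C (signedEsymm ι j)) *
      Polynomial.X ^ (n - Fintype.card ι - 1) * Polynomial.X ^ (Fintype.card ι - j)) * h1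
  · intro j _ hj
    rw [signedEsymm_eq_zero (by simpa using hj)]
    simp

lemma rootPrimitive_hasSymmCoeffs (n : ℕ) : HasSymmCoeffs (rootPrimitive ι n) := by
  intro τ
  simp only [rootPrimitive, Polynomial.map_sum, Polynomial.map_mul, Polynomial.map_C,
    Polynomial.map_pow, Polynomial.map_X]
  refine Finset.sum_congr rfl fun j _ => ?_
  congr 2
  simp [rename_signedEsymm]

section

lemma degree_finsetSum_lt {A α : Type*} [CommRing A] {s : Finset α} {f : α → Polynomial A} {n : ℕ}
    (h : ∀ i ∈ s, (f i).degree < n) : (∑ i ∈ s, f i).degree < n := by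
  simp only [← Polynomial.mem_degreeLT] at h ⊢
  exact Submodule.sum_mem _ h

variable {ι : Type*} [Fintype ι]

/-- A basis of `ℂ[x_i][t]` adapted to the polynomials whose derivative is divisible by
`∏ (t - x_i)` and to the multiples of `∏ (t - x_i) ^ 2`. -/
noncomputable def adaptedBasis (ι : Type*) [Fintype ι] (n : ℕ) : Polynomial (MvPolynomial ι ℂ) :=
  if n ≤ Fintype.card ι then Polynomial.X ^ n
  else if n < 2 * Fintype.card ι then Polynomial.C (C (n : ℂ)) * rootPrimitive ι n
  else rootPoly ι ^ 2 * Polynomial.X ^ (n - 2 * Fintype.card ι)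

lemma adaptedBasis_of_le {n : ℕ} (hn : n ≤ Fintype.card ι) :
    adaptedBasis ι n = Polynomial.X ^ n := if_pos hn

lemma adaptedBasis_zero : adaptedBasis ι 0 = 1 := by
  rw [adaptedBasis_of_le (Nat.zero_le _), pow_zero]

lemma C_mul_rootPrimitive {n : ℕ} (hn : n ≠ 0) : ∃ q : Polynomial (MvPolynomial ι ℂ),
    q.degree < n ∧ Polynomial.C (C (n : ℂ)) * rootPrimitive ι n = Polynomial.X ^ n + q := by
  obtain ⟨m, rfl⟩ := Nat.exists_eq_succ_of_ne_zero hn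
  rw [rootPrimitive, Finset.sum_range_succ', mul_add]
  refine ⟨_, ?_, (add_comm _ _).trans (congrArg (· + _) ?_)⟩
  · rw [Finset.mul_sum]
    refine degree_finsetSum_lt fun j hj => ?_
    rw [← mul_assoc, ← Polynomial.C_mul]
    refine (Polynomial.degree_C_mul_X_pow_le _ _).trans_lt ?_
    exact_mod_cast (by omega : m.succ - (j + 1) < m.succ)
  · have hne : ((m.succ : ℕ) : ℂ) ≠ 0 := Nat.cast_ne_zero.2 hn
    rw [signedEsymm_zero, ← mul_assoc, ← Polynomial.C_mul, one_mul, ← C_mul, Nat.sub_zero,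
      mul_one_div_cancel hne, map_one, map_one, one_mul]

lemma adaptedBasis_monic_and_natDegree (n : ℕ) :
    (adaptedBasis ι n).Monic ∧ (adaptedBasis ι n).natDegree = n := by
  unfold adaptedBasis
  split_ifs with h1 h2
  · exact ⟨Polynomial.monic_X_pow n, Polynomial.natDegree_X_pow n⟩
  · obtain ⟨q, hq, h⟩ := C_mul_rootPrimitive (ι := ι) (n := n) (by omega)
    rw [h]
    exact ⟨Polynomial.monic_X_pow_add hq, Polynomial.natDegree_eq_of_degree_eq_some (by
      rw [Polynomial.degree_add_eq_left_of_degree_lt (by simpa using hq), Polynomial.degree_X_pow])⟩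
  · have hm := (rootPoly_monic (ι := ι)).pow 2
    refine ⟨hm.mul (Polynomial.monic_X_pow _), ?_⟩
    rw [hm.natDegree_mul (Polynomial.monic_X_pow _), rootPoly_monic.natDegree_pow,
      rootPoly_natDegree, Polynomial.natDegree_X_pow]
    omega

lemma adaptedBasis_hasSymmCoeffs (n : ℕ) : HasSymmCoeffs (adaptedBasis ι n) := by
  intro τ
  unfold adaptedBasis
  split_ifs with h1 h2
  · simp
  · rw [Polynomial.map_mul, rootPrimitive_hasSymmCoeffs]
    simp
  · rw [Polynomial.map_mul, Polynomial.map_pow, rootPoly_hasSymmCoeffs]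
    simp

lemma rootPoly_dvd_derivative_adaptedBasis {n : ℕ} (hn : n ∉ Finset.Icc 1 (Fintype.card ι)) :
    rootPoly ι ∣ Polynomial.derivative (adaptedBasis ι n) := by
  rw [Finset.mem_Icc] at hn
  unfold adaptedBasis
  split_ifs with h1 h2
  · obtain rfl : n = 0 := by omega
    simp
  · rw [Polynomial.derivative_C_mul, derivative_rootPrimitive (by omega)]
    exact ((dvd_mul_left _ _).mul_left _)
  · rw [Polynomial.derivative_mul, sq, Polynomial.derivative_mul]
    refine dvd_add (Dvd.dvd.mul_right (dvd_add ?_ ?_) _) (Dvd.dvd.mul_right (dvd_mul_right _ _) _)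
    · exact dvd_mul_left _ _
    · exact dvd_mul_right _ _

lemma adaptedBasis_eval_eq_zero [Nonempty ι] {n : ℕ} (hn : 2 * Fintype.card ι ≤ n) (a : ι) :
    (adaptedBasis ι n).eval (X a) = 0 := by
  have hpos : 0 < Fintype.card ι := Fintype.card_pos
  rw [adaptedBasis, if_neg (by omega), if_neg (by omega)]
  simp [rootPoly_eval]

/-- Coefficients at the part of the adapted basis not satisfying the derivative condition vanish
as soon as the derivative of the whole combination vanishes at all the `x_i`. -/
lemma coeff_eq_zero_of_derivative (D : ℕ) (c : ℕ → MvPolynomial ι ℂ)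
    (h : ∀ a : ι, ∑ k ∈ Finset.range D,
      c k * (Polynomial.derivative (adaptedBasis ι k)).eval (X a) = 0) :
    ∀ k < D, k ∈ Finset.Icc 1 (Fintype.card ι) → c k = 0 := by
  classical
  set N := Fintype.card ι
  let g : Polynomial (MvPolynomial ι ℂ) := ∑ k ∈ (Finset.range D).filter (· ∈ Finset.Icc 1 N),
    Polynomial.C (c k) * adaptedBasis ι k
  have hg' : rootPoly ι ∣ Polynomial.derivative g := by
    refine rootPoly_dvd fun a => ?_
    have h1 := h a
    rw [← Finset.sum_filter_add_sum_filter_not _ (· ∈ Finset.Icc 1 N)] at h1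
    rw [Finset.sum_eq_zero (s := (Finset.range D).filter (¬ · ∈ Finset.Icc 1 N)) (fun k hk => ?_),
      add_zero] at h1
    · simpa [g, Polynomial.eval_finsetSum, Polynomial.derivative_sum,
        Polynomial.derivative_C_mul] using h1
    · obtain ⟨u, hu⟩ := rootPoly_dvd_derivative_adaptedBasis (Finset.mem_filter.1 hk).2
      rw [hu, Polynomial.eval_mul, rootPoly_eval, zero_mul, mul_zero]
  have hdeg : (Polynomial.derivative g).degree < (rootPoly ι).degree := by
    rw [Polynomial.degree_eq_natDegree rootPoly_monic.ne_zero, rootPoly_natDegree,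
      Polynomial.derivative_sum]
    refine degree_finsetSum_lt fun k hk => ?_
    have hk2 := Finset.mem_Icc.1 (Finset.mem_filter.1 hk).2
    rw [adaptedBasis_of_le hk2.2, Polynomial.derivative_C_mul, Polynomial.derivative_X_pow,
      ← mul_assoc, ← Polynomial.C_mul]
    refine (Polynomial.degree_C_mul_X_pow_le _ _).trans_lt ?_
    exact_mod_cast (by omega : k - 1 < N)
  have h0 : Polynomial.derivative g = 0 := Polynomial.eq_zero_of_dvd_of_degree_lt hg' hdeg
  have hconst := Polynomial.derivative_eq_zero.1 h0
  rw [Polynomial.natDegree_eq_zero] at hconst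
  obtain ⟨x, hx⟩ := hconst
  have hu := expansion_unique (fun n => (adaptedBasis_monic_and_natDegree (ι := ι) n).1)
    (fun n => (adaptedBasis_monic_and_natDegree (ι := ι) n).2) (D + 1)
    (fun k => (if k ∈ Finset.Icc 1 N then (if k < D then c k else 0) else 0) -
      (if k = 0 then x else 0)) (by
      simp only [map_sub, sub_mul, Finset.sum_sub_distrib]
      rw [sub_eq_zero, Finset.sum_range_succ]
      have h1 : ∑ k ∈ Finset.range D, Polynomial.C
          (if k ∈ Finset.Icc 1 N then (if k < D then c k else 0) else 0) * adaptedBasis ι k =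
            g := by
        simp only [g, Finset.sum_filter]
        refine Finset.sum_congr rfl fun k hk => ?_
        rw [if_pos (Finset.mem_range.1 hk)]
        split_ifs <;> simp
      rw [h1, ← hx, Finset.sum_eq_single 0]
      · simp [adaptedBasis_zero]
      · intro k _ hk
        simp [hk]
      · simp)
  intro k hk hkN
  have := hu k (by omega)
  have hk0 : k ≠ 0 := by
    rintro rfl
    simp at hkN
  simpa [hkN, hk, hk0] using this

/-- The indices of the adapted basis surviving evaluation at the `x_i`. -/
def survivingIndices (N : ℕ) : Finset ℕ := (Finset.range (2 * N)).filter (· ∉ Finset.Icc 1 N)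

lemma coeff_eq_zero_of_eval (c : ℕ → MvPolynomial ι ℂ)
    (h : ∀ a : ι, ∑ k ∈ survivingIndices (Fintype.card ι),
      c k * (adaptedBasis ι k).eval (X a) = 0) :
    ∀ k ∈ survivingIndices (Fintype.card ι), c k = 0 := by
  classical
  set N := Fintype.card ι
  let g : Polynomial (MvPolynomial ι ℂ) := ∑ k ∈ survivingIndices N,
    Polynomial.C (c k) * adaptedBasis ι k
  have hg : rootPoly ι ^ 2 ∣ g := by
    refine rootPoly_sq_dvd (fun a => ?_) ?_
    · simpa [g, Polynomial.eval_finsetSum] using h a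
    · rw [Polynomial.derivative_sum]
      refine Finset.dvd_sum fun k hk => ?_
      rw [Polynomial.derivative_C_mul]
      exact (rootPoly_dvd_derivative_adaptedBasis (Finset.mem_filter.1 hk).2).mul_left _
  have hdeg : g.degree < (rootPoly ι ^ 2).degree := by
    rw [Polynomial.degree_eq_natDegree (rootPoly_monic.pow 2).ne_zero, rootPoly_monic.natDegree_pow,
      rootPoly_natDegree]
    refine degree_finsetSum_lt fun k hk => ?_
    have hk2 := Finset.mem_range.1 (Finset.mem_filter.1 hk).1
    refine (Polynomial.smul_eq_C_mul (c k) ▸ Polynomial.degree_smul_le _ _).trans_lt ?_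
    rw [Polynomial.degree_eq_natDegree (adaptedBasis_monic_and_natDegree k).1.ne_zero,
      (adaptedBasis_monic_and_natDegree k).2]
    exact_mod_cast hk2
  have h0 : g = 0 := Polynomial.eq_zero_of_dvd_of_degree_lt hg hdeg
  have hu := expansion_unique (fun n => (adaptedBasis_monic_and_natDegree (ι := ι) n).1)
    (fun n => (adaptedBasis_monic_and_natDegree (ι := ι) n).2) (2 * N)
    (fun k => if k ∉ Finset.Icc 1 N then c k else 0) (by
      rw [← h0]
      simp only [g, survivingIndices, Finset.sum_filter]
      refine Finset.sum_congr rfl fun k _ => ?_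
      split_ifs <;> simp)
  intro k hk
  have := hu k (Finset.mem_range.1 (Finset.mem_filter.1 hk).1)
  rwa [if_pos (Finset.mem_filter.1 hk).2] at this

end

section

/-- The ring of polynomials in `t` with symmetric coefficients. -/
noncomputable def symmCoeffSubring (ι : Type*) :
    Subring (Polynomial (MvPolynomial ι ℂ)) where
  carrier := {g | HasSymmCoeffs g}
  mul_mem' hf hg τ := by rw [Polynomial.map_mul, hf τ, hg τ]
  one_mem' τ := Polynomial.map_one _
  add_mem' hf hg τ := by rw [Polynomial.map_add, hf τ, hg τ]
  zero_mem' τ := Polynomial.map_zero _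
  neg_mem' hf τ := by rw [Polynomial.map_neg, hf τ]

lemma hasSymmCoeffs_C {ι : Type*} {p : MvPolynomial ι ℂ} (hp : p.IsSymmetric) :
    HasSymmCoeffs (Polynomial.C p) := fun τ => by
  rw [Polynomial.map_C]; exact congrArg _ (hp τ)

lemma HasSymmCoeffs.coeff {ι : Type*} {g : Polynomial (MvPolynomial ι ℂ)}
    (hg : HasSymmCoeffs g) (n : ℕ) : (g.coeff n).IsSymmetric := fun τ => by
  conv_rhs => rw [← hg τ, Polynomial.coeff_map]
  rfl

lemma HasSymmCoeffs.eval {ι : Type*} {g : Polynomial (MvPolynomial ι ℂ)} (hg : HasSymmCoeffs g)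
    (τ : Equiv.Perm ι) (p : MvPolynomial ι ℂ) : rename τ (g.eval p) = g.eval (rename τ p) := by
  conv_rhs => rw [← hg τ]
  exact (Polynomial.eval_map_apply _ _).symm

lemma HasSymmCoeffs.derivative {ι : Type*} {g : Polynomial (MvPolynomial ι ℂ)}
    (hg : HasSymmCoeffs g) : HasSymmCoeffs (Polynomial.derivative g) := fun τ => by
  rw [← Polynomial.derivative_map, hg τ]

variable {ι : Type*}

/-- Symmetric polynomials in all variables but `X o` are polynomials in `X o` with coefficients
symmetric in all variables. -/
noncomputable def evalSubring (o : ι) : Subring (MvPolynomial ι ℂ) :=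
  (symmCoeffSubring ι).map (Polynomial.evalRingHom (X o))

lemma mem_evalSubring {o : ι} {t : MvPolynomial ι ℂ} :
    t ∈ evalSubring o ↔ ∃ g, HasSymmCoeffs g ∧ g.eval (X o) = t := Iff.rfl

lemma isSymmetric_mem_evalSubring (o : ι) {p : MvPolynomial ι ℂ} (hp : p.IsSymmetric) :
    p ∈ evalSubring o :=
  ⟨Polynomial.C p, hasSymmCoeffs_C hp, by simp⟩

lemma X_mem_evalSubring (o : ι) : X o ∈ evalSubring o :=
  ⟨Polynomial.X, fun τ => Polynomial.map_X _, by simp⟩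

variable [Fintype ι] [DecidableEq ι]

lemma rootPoly_eq_mul (o : ι) : rootPoly ι = (Polynomial.X - Polynomial.C (X o)) *
    ∏ i : {l // l ≠ o}, (Polynomial.X - Polynomial.C (X i.1)) :=
  Fintype.prod_eq_mul_prod_subtype_ne _ o

lemma coeff_prod_ne_mem_evalSubring (o : ι) (i : ℕ) :
    (∏ i : {l // l ≠ o}, (Polynomial.X - Polynomial.C (X i.1 : MvPolynomial ι ℂ))).coeff i ∈
      evalSubring o := by
  set Q := ∏ i : {l // l ≠ o}, (Polynomial.X - Polynomial.C (X i.1 : MvPolynomial ι ℂ)) with hQ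
  suffices ∀ m i, Q.natDegree < i + m → Q.coeff i ∈ evalSubring o from
    this (Q.natDegree + 1) i (by omega)
  intro m
  induction m with
  | zero =>
    intro i hi
    rw [Polynomial.coeff_eq_zero_of_natDegree_lt (by omega)]
    exact zero_mem _
  | succ m ih =>
    intro i hi
    have h := congrArg (fun p => Polynomial.coeff p (i + 1)) (rootPoly_eq_mul o)
    simp only [← hQ, sub_mul, Polynomial.coeff_sub, Polynomial.coeff_X_mul,
      Polynomial.coeff_C_mul] at h
    rw [show Q.coeff i = (rootPoly ι).coeff (i + 1) + X o * Q.coeff (i + 1) by rw [h]; ring]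
    exact add_mem (isSymmetric_mem_evalSubring o (rootPoly_hasSymmCoeffs.coeff _))
      (mul_mem (X_mem_evalSubring o) (ih _ (by omega)))

lemma esymm_ne_mem_evalSubring (o : ι) (n : ℕ) :
    ∑ t ∈ Finset.powersetCard n (Finset.univ : Finset {l // l ≠ o}),
      ∏ i ∈ t, (X i.1 : MvPolynomial ι ℂ) ∈ evalSubring o := by
  by_cases hn : n ≤ Fintype.card {l // l ≠ o}
  · have h := Multiset.prod_X_sub_C_coeff
      ((Finset.univ : Finset {l // l ≠ o}).val.map fun i => (X i.1 : MvPolynomial ι ℂ))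
      (k := Fintype.card {l // l ≠ o} - n) (by simp)
    rw [Multiset.map_map, Multiset.card_map, Finset.card_val, Finset.card_univ,
      Nat.sub_sub_self hn, Finset.esymm_map_val] at h
    have h2 := coeff_prod_ne_mem_evalSubring o (Fintype.card {l // l ≠ o} - n)
    have h3 := mul_mem (pow_mem (neg_mem (one_mem (evalSubring o))) n) h2
    rw [Finset.prod_eq_multiset_prod] at h3
    simp only [Function.comp_def] at h
    rw [h, ← mul_assoc, ← mul_pow] at h3
    simpa using h3
  · rw [Finset.powersetCard_eq_empty.2 (by simpa using hn)]
    simp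

lemma mem_evalSubring_of_rename_eq (o : ι) (t : MvPolynomial ι ℂ)
    (ht : ∀ τ : Equiv.Perm ι, τ o = o → rename τ t = t) : t ∈ evalSubring o := by
  let e : {l // l ≠ o} ⊕ Unit ≃ ι :=
    { toFun := Sum.elim Subtype.val fun _ => o
      invFun := fun l => if h : l = o then Sum.inr () else Sum.inl ⟨l, h⟩
      left_inv := by 
        rintro (⟨l, h⟩ | ⟨⟩)
        · simp [h]
        · simp
      right_inv := fun l => by by_cases h : l = o <;> simp [h] }
  let Φ : MvPolynomial ι ℂ ≃ₐ[ℂ] MvPolynomial {l // l ≠ o} (MvPolynomial Unit ℂ) :=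
    (renameEquiv ℂ e.symm).trans (sumAlgEquiv ℂ _ _)
  have hΦX : ∀ l : {l // l ≠ o}, Φ.symm (X l) = X l.1 := by
    intro l
    rw [AlgEquiv.symm_apply_eq]
    simp [Φ, e, l.2]
  have hΦo : Φ.symm (C (X ())) = X o := by
    rw [AlgEquiv.symm_apply_eq]
    simp [Φ, e]
  have hsymm : (Φ t).IsSymmetric := by
    intro σ
    have h := ht (e.permCongr (Equiv.sumCongr σ (Equiv.refl Unit))) (by
      simp [e, Equiv.permCongr_apply])
    conv_rhs => rw [← h]
    have hcomp : ((rename σ :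
        MvPolynomial {l // l ≠ o} (MvPolynomial Unit ℂ) →ₐ[MvPolynomial Unit ℂ]
        MvPolynomial {l // l ≠ o} (MvPolynomial Unit ℂ)).restrictScalars ℂ).comp Φ.toAlgHom =
        Φ.toAlgHom.comp (rename (e.permCongr (Equiv.sumCongr σ (Equiv.refl Unit)))) := by
      ext l
      by_cases hl : l = o
      · subst hl
        simp [Φ, e, Equiv.permCongr_apply]
      · simp [Φ, e, Equiv.permCongr_apply, hl, (σ ⟨l, hl⟩).2]
    exact congrArg (fun F => F t) hcomp
  obtain ⟨p, hp⟩ := esymmAlgHom_surjective (MvPolynomial Unit ℂ)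
    (le_refl (Fintype.card {l // l ≠ o})) ⟨Φ t, hsymm⟩
  have hp' : t = Φ.symm (aeval (fun i : Fin (Fintype.card {l // l ≠ o}) =>
      esymm {l // l ≠ o} (MvPolynomial Unit ℂ) (i + 1)) p) := by
    rw [← esymmAlgHom_apply, hp, AlgEquiv.symm_apply_apply]
  rw [hp']
  clear hp hp' hsymm
  have hC : ∀ c : ℂ, (C c : MvPolynomial ι ℂ) ∈ evalSubring o := fun c =>
    isSymmetric_mem_evalSubring o (IsSymmetric.C c)
  induction p using MvPolynomial.induction_on with
  | C q =>
    rw [aeval_C, algebraMap_eq]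
    induction q using MvPolynomial.induction_on with
    | C c =>
      have : (C (C c) : MvPolynomial {l // l ≠ o} (MvPolynomial Unit ℂ)) = algebraMap ℂ _ c := rfl
      rw [this, AlgEquiv.commutes]
      exact hC c
    | add p q hp hq => rw [C_add, map_add]; exact add_mem hp hq
    | mul_X q i hq =>
      rw [C_mul, map_mul, hΦo]
      exact mul_mem hq (X_mem_evalSubring o)
  | add p q hp hq => rw [map_add, map_add]; exact add_mem hp hq
  | mul_X p i hp =>
    rw [map_mul, map_mul, aeval_X]
    refine mul_mem hp ?_
    simp only [esymm, map_sum, map_prod, hΦX]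
    exact esymm_ne_mem_evalSubring o _

lemma X_sub_X_dvd_iff {ι : Type*} [DecidableEq ι] (i j : ι) (p : MvPolynomial ι ℂ) :
    X i - X j ∣ p ↔ aeval (Function.update X i (X j)) p = (0 : MvPolynomial ι ℂ) := by
  constructor
  · rintro ⟨q, rfl⟩
    rw [map_mul, map_sub, aeval_X, aeval_X, Function.update_self]
    by_cases h : j = i
    · subst h; simp
    · simp [Function.update_of_ne h]
  · intro h
    suffices X i - X j ∣ p - aeval (Function.update X i (X j)) p by rwa [h, sub_zero] at this
    clear h
    induction p using MvPolynomial.induction_on with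
    | C c => simp
    | add p q hp hq => rw [map_add, add_sub_add_comm]; exact dvd_add hp hq
    | mul_X p k hp =>
      rw [map_mul, aeval_X]
      by_cases hk : k = i
      · subst hk
        rw [Function.update_self, show p * X k - aeval (Function.update X k (X j)) p * X j =
          p * (X k - X j) + (p - aeval (Function.update X k (X j)) p) * X j by ring]
        exact dvd_add (dvd_mul_left _ _) (hp.mul_right _)
      · rw [Function.update_of_ne hk, ← sub_mul]
        exact hp.mul_right _

lemma X_sub_X_ne_zero {ι : Type*} {i j : ι} (h : i ≠ j) : (X i - X j : MvPolynomial ι ℂ) ≠ 0 :=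
  sub_ne_zero.2 fun h' => h (X_injective h')

lemma prime_X_sub_X {ι : Type*} {i j : ι} (h : i ≠ j) :
    Prime (X i - X j : MvPolynomial ι ℂ) := by
  classical
  refine ⟨X_sub_X_ne_zero h, fun hu => ?_, fun p q => ?_⟩
  · have := (X_sub_X_dvd_iff i j 1).1 hu.dvd
    simp at this
  · simp only [X_sub_X_dvd_iff, map_mul, mul_eq_zero, imp_self]

lemma exists_adapted_expansion (o : ι) (t : MvPolynomial ι ℂ)
    (ht : ∀ τ : Equiv.Perm ι, τ o = o → rename τ t = t)
    (hd : ∀ l, l ≠ o → (X o - X l) ^ 2 ∣ t - rename (Equiv.swap o l) t) :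
    ∃ ψ : ℕ → MvPolynomial ι ℂ, (∀ k, (ψ k).IsSymmetric) ∧
      t = ∑ k ∈ survivingIndices (Fintype.card ι), ψ k * (adaptedBasis ι k).eval (X o) := by
  obtain ⟨g₀, hg₀, hg₀t⟩ := mem_evalSubring.1 (mem_evalSubring_of_rename_eq o t ht)
  set q := (Polynomial.derivative (rootPoly ι)).eval (X o) with hq
  have hqprod : q = ∏ l : {l // l ≠ o}, (X o - X l.1) := by
    rw [hq, rootPoly_eq_mul o, Polynomial.derivative_mul]
    simp [Polynomial.eval_prod]
  have hq0 : q ≠ 0 := by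
    rw [hqprod]
    exact Finset.prod_ne_zero_iff.2 fun l _ => X_sub_X_ne_zero l.2.symm
  have hdvd : q ∣ (Polynomial.derivative g₀).eval (X o) := by
    rw [hqprod]
    refine Finset.prod_dvd_of_isRelPrime (fun a _ b _ hab => ?_) fun l _ => ?_
    · rw [Function.onFun, (prime_X_sub_X a.2.symm).irreducible.isRelPrime_iff_not_dvd,
        ← dvd_neg, neg_sub, ← dvd_neg, neg_sub, ← neg_dvd, neg_sub, X_sub_X_dvd_iff, map_sub,
        aeval_X, aeval_X, Function.update_of_ne a.2.symm,
        Function.update_of_ne (Subtype.coe_injective.ne hab.symm)]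
      exact X_sub_X_ne_zero b.2.symm
    · obtain ⟨k, hk⟩ := Polynomial.binomExpansion g₀ (X o) (X l.1 - X o)
      have h1 := hd l l.2
      rw [← hg₀t, hg₀.eval, rename_X, Equiv.swap_apply_left] at h1
      rw [add_sub_cancel] at hk
      rw [hk] at h1
      have h2 : (X o - X l.1) ^ 2 ∣ (X o - X l.1) * (Polynomial.derivative g₀).eval (X o) := by
        have h3 := dvd_add h1 (dvd_mul_left ((X o - X l.1) ^ 2) k)
        convert h3 using 1
        ring
      rw [sq] at h2
      exact (mul_dvd_mul_iff_left (X_sub_X_ne_zero l.2.symm)).1 h2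
  obtain ⟨h, hh⟩ := hdvd
  obtain ⟨h₀, hh₀, hh₀h⟩ := mem_evalSubring.1 (mem_evalSubring_of_rename_eq o h fun τ hτ => by
    have h1 := congrArg (rename τ) hh
    rw [map_mul, hg₀.derivative.eval, hq, rootPoly_hasSymmCoeffs.derivative.eval, rename_X, hτ,
      hh] at h1
    exact (mul_left_cancel₀ hq0 h1).symm)
  set g := g₀ - rootPoly ι * h₀ with hg
  have hgs : HasSymmCoeffs g :=
    (symmCoeffSubring ι).sub_mem hg₀ ((symmCoeffSubring ι).mul_mem
      rootPoly_hasSymmCoeffs hh₀)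
  have hgo : g.eval (X o) = t := by simp [hg, rootPoly_eval, hg₀t]
  have hgo' : (Polynomial.derivative g).eval (X o) = 0 := by
    simp [hg, Polynomial.derivative_mul, rootPoly_eval, hh, hh₀h, hq]
  have hg' : ∀ a, (Polynomial.derivative g).eval (X a) = 0 := fun a => by
    have := hgs.derivative.eval (Equiv.swap o a) (X o)
    rwa [hgo', map_zero, rename_X, Equiv.swap_apply_left, eq_comm] at this
  have hmonic := fun n => (adaptedBasis_monic_and_natDegree (ι := ι) n).1
  have hdeg := fun n => (adaptedBasis_monic_and_natDegree (ι := ι) n).2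
  set D := max (g.natDegree + 1) (2 * Fintype.card ι)
  obtain ⟨c, hc⟩ := exists_expansion hmonic hdeg D g
    (Polynomial.degree_le_natDegree.trans_lt (by
      exact_mod_cast lt_of_lt_of_le (Nat.lt_succ_self _) (le_max_left _ _)))
  have hcs : ∀ k < D, (c k).IsSymmetric := by
    intro k hk τ
    have h1 := hgs τ
    rw [hc] at h1
    simp only [Polynomial.map_sum, Polynomial.map_mul, Polynomial.map_C,
      adaptedBasis_hasSymmCoeffs _ τ] at h1
    rw [← sub_eq_zero, ← Finset.sum_sub_distrib] at h1
    simp only [← sub_mul, ← Polynomial.C_sub] at h1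
    exact sub_eq_zero.1 (expansion_unique hmonic hdeg D _ h1 k hk)
  have hc0 := coeff_eq_zero_of_derivative D c fun a => by
    have := hg' a
    rw [hc] at this
    simpa [Polynomial.derivative_sum, Polynomial.eval_finsetSum] using this
  refine ⟨fun k => if k < D then c k else 0, fun k => ?_, ?_⟩
  · dsimp only
    split_ifs with hk
    · exact hcs k hk
    · exact IsSymmetric.zero
  · have : Nonempty ι := ⟨o⟩
    rw [← hgo, hc, Polynomial.eval_finsetSum]
    symm
    simp only [Polynomial.eval_mul, Polynomial.eval_C]
    have hsub : survivingIndices (Fintype.card ι) ⊆ Finset.range D := fun k hk =>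
      Finset.mem_range.2 ((Finset.mem_range.1 (Finset.mem_filter.1 hk).1).trans_le
        (le_max_right _ _))
    rw [← Finset.sum_subset hsub fun k hk hk' => ?_]
    · exact Finset.sum_congr rfl fun k hk => by rw [if_pos (Finset.mem_range.1 (hsub hk))]
    · by_cases hk2 : k ∈ Finset.Icc 1 (Fintype.card ι)
      · rw [hc0 k (Finset.mem_range.1 hk) hk2, zero_mul]
      · have : 2 * Fintype.card ι ≤ k := by
          by_contra hlt
          exact hk' (Finset.mem_filter.2 ⟨Finset.mem_range.2 (by omega), hk2⟩)
        rw [adaptedBasis_eval_eq_zero this, mul_zero]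

end

section PolyProd
variable {A κ : Type*} [CommRing A] [Fintype κ]

/-- The product `∏ p_i(y_i)` of polynomials in separate variables. -/
noncomputable def polyProd (p : κ → Polynomial A) : MvPolynomial κ A :=
  ∏ i, Polynomial.aeval (X i) (p i)

lemma coeff_polyProd (p : κ → Polynomial A) (n : κ →₀ ℕ) :
    coeff n (polyProd p) = ∏ i, (p i).coeff (n i) := by
  classical
  set D := Finset.univ.sup fun i => max ((p i).natDegree + 1) (n i + 1)
  have hD : ∀ i, (p i).natDegree < D ∧ n i < D := fun i => by
    have : max ((p i).natDegree + 1) (n i + 1) ≤ D := Finset.le_sup (f := fun i =>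
      max ((p i).natDegree + 1) (n i + 1)) (Finset.mem_univ i)
    omega
  have h : polyProd p = ∑ m ∈ Fintype.piFinset fun _ : κ => Finset.range D,
      monomial (Finsupp.equivFunOnFinite.symm m) (∏ i, (p i).coeff (m i)) := by
    rw [polyProd]
    have : ∀ i, Polynomial.aeval (X i : MvPolynomial κ A) (p i) =
        ∑ k ∈ Finset.range D, C ((p i).coeff k) * X i ^ k := fun i => by
      rw [Polynomial.aeval_eq_sum_range' (hD i).1]
      simp [smul_eq_C_mul]
    simp only [this]
    rw [Finset.prod_univ_sum]
    refine Finset.sum_congr rfl fun m _ => ?_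
    rw [Finset.prod_mul_distrib, monomial_eq, map_prod, Finsupp.prod_fintype _ _ (by simp)]
    rfl
  rw [h, coeff_sum, Finset.sum_eq_single (n : κ → ℕ)]
  · simp [coeff_monomial]
  · intro m _ hm
    rw [coeff_monomial, if_neg]
    rintro rfl
    exact hm rfl
  · intro hn
    exact absurd (Fintype.mem_piFinset.2 fun i => Finset.mem_range.2 (hD i).2) hn

lemma rename_polyProd (p : κ → Polynomial A) (σ : Equiv.Perm κ) :
    rename σ (polyProd p) = polyProd (p ∘ σ.symm) := by
  rw [polyProd, map_prod, polyProd, ← Equiv.prod_comp σ (fun i =>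
    Polynomial.aeval (X i) ((p ∘ σ.symm) i))]
  refine Finset.prod_congr rfl fun i _ => ?_
  rw [← Polynomial.aeval_algHom_apply, rename_X, Function.comp_apply, Equiv.symm_apply_apply]

variable [DecidableEq κ]

lemma polyProd_eq_mul (p : κ → Polynomial A) (j : κ) : polyProd p =
    Polynomial.aeval (X j) (p j) * ∏ i ∈ Finset.univ.erase j, Polynomial.aeval (X i) (p i) :=
  (Finset.mul_prod_erase _ _ (Finset.mem_univ j)).symm

lemma polyProd_update (p : κ → Polynomial A) (j : κ) (q : Polynomial A) :
    polyProd (Function.update p j q) =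
      Polynomial.aeval (X j) q * ∏ i ∈ Finset.univ.erase j, Polynomial.aeval (X i) (p i) := by
  rw [polyProd_eq_mul _ j, Function.update_self]
  congr 1
  refine Finset.prod_congr rfl fun i hi => ?_
  rw [Function.update_of_ne (Finset.ne_of_mem_erase hi)]

lemma pderiv_polyProd (p : κ → Polynomial A) (j : κ) : pderiv j (polyProd p) =
    polyProd (Function.update p j (Polynomial.derivative (p j))) := by
  have hq : ∀ (i : κ) (q : Polynomial A), pderiv j (Polynomial.aeval (X i) q) =
      Polynomial.aeval (X i) (Polynomial.derivative q) * pderiv j (X i) := fun i q => by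
    rw [Derivation.map_aeval, smul_eq_mul]
  rw [polyProd_update, polyProd_eq_mul p j, Derivation.leibniz, hq, pderiv_X_self, smul_eq_mul,
    smul_eq_mul, mul_one]
  have : pderiv j (∏ i ∈ Finset.univ.erase j, Polynomial.aeval (X i : MvPolynomial κ A) (p i)) =
      0 := by
    refine Finset.prod_induction _ (fun f => pderiv j f = 0) (fun f g hf hg => ?_) (by simp)
      fun i hi => ?_
    · rw [Derivation.leibniz, hf, hg]; simp
    · rw [hq, pderiv_X_of_ne (Finset.ne_of_mem_erase hi), mul_zero]
  rw [this]
  ring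

/-- Substitution of a constant for one variable. -/
noncomputable def substC (j : κ) (a : A) : MvPolynomial κ A →ₐ[A] MvPolynomial κ A :=
  aeval (Function.update X j (C a))

lemma substC_polyProd (p : κ → Polynomial A) (j : κ) (a : A) : substC j a (polyProd p) =
    C ((p j).eval a) * polyProd (Function.update p j 1) := by
  rw [polyProd_update, polyProd_eq_mul p j, map_mul, map_one, one_mul, map_prod, substC,
    ← Polynomial.aeval_algHom_apply, aeval_X, Function.update_self]
  congr 1
  · rw [← algebraMap_eq, Polynomial.aeval_algebraMap_apply, Polynomial.coe_aeval_eq_eval]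
  · refine Finset.prod_congr rfl fun i hi => ?_
    rw [← Polynomial.aeval_algHom_apply, aeval_X, Function.update_of_ne (Finset.ne_of_mem_erase hi)]

/-- Multi-indices all of whose entries are less than `D`. -/
abbrev box (κ : Type*) [Fintype κ] [DecidableEq κ] (D : ℕ) : Finset (κ → ℕ) :=
  Fintype.piFinset fun _ => Finset.range D

/-- The linear combination of products of members of `e`, with coefficients `φ`. -/
noncomputable def boxSum (e : ℕ → Polynomial A) (D : ℕ) (φ : (κ → ℕ) → A) : MvPolynomial κ A :=
  ∑ m ∈ box κ D, C (φ m) * polyProd fun i => e (m i)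

variable {e : ℕ → Polynomial A}

lemma mem_ideal_of_boxSum (he : ∀ n, (e n).Monic) (hd : ∀ n, (e n).natDegree = n) (D : ℕ)
    (φ : (κ → ℕ) → A) (I : Ideal A) (h : ∀ n, coeff n (boxSum e D φ) ∈ I) :
    ∀ m ∈ box κ D, φ m ∈ I := by
  classical
  by_contra! hne
  obtain ⟨m, hm, hmax⟩ := Finset.exists_max_image ((box κ D).filter (φ · ∉ I)) (fun m => ∑ i, m i)
    (by obtain ⟨m, hm, h⟩ := hne; exact ⟨m, Finset.mem_filter.2 ⟨hm, h⟩⟩)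
  rw [Finset.mem_filter] at hm
  refine hm.2 ?_
  have h1 := h (Finsupp.equivFunOnFinite.symm m)
  rw [boxSum, coeff_sum, ← Finset.add_sum_erase _ _ hm.1] at h1
  simp only [coeff_C_mul, coeff_polyProd, Finsupp.coe_equivFunOnFinite_symm] at h1
  have h2 : ∀ i, (e (m i)).coeff (m i) = 1 := fun i => by
    have := he (m i)
    rwa [Polynomial.Monic, Polynomial.leadingCoeff, hd] at this
  simp only [h2, Finset.prod_const_one, mul_one] at h1
  refine (Submodule.add_mem_iff_left I (Submodule.sum_mem _ fun m' hm' => ?_)).1 h1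
  rw [Finset.mem_erase] at hm'
  by_cases hle : ∀ i, m i ≤ m' i
  · refine I.mul_mem_right _ ?_
    by_contra hI
    have h3 := hmax m' (Finset.mem_filter.2 ⟨hm'.2, hI⟩)
    have h4 : ∑ i, m i = ∑ i, m' i := le_antisymm (Finset.sum_le_sum fun i _ => hle i) h3
    refine hm'.1 (funext fun i => ?_)
    exact ((Finset.sum_eq_sum_iff_of_le fun i _ => hle i).1 h4 i (Finset.mem_univ i)).symm
  · push Not at hle
    obtain ⟨i, hi⟩ := hle
    rw [Finset.prod_eq_zero (Finset.mem_univ i), mul_zero]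
    · exact zero_mem _
    · exact Polynomial.coeff_eq_zero_of_natDegree_lt (by rwa [hd])

lemma eq_zero_of_boxSum (he : ∀ n, (e n).Monic) (hd : ∀ n, (e n).natDegree = n) (D : ℕ)
    (φ : (κ → ℕ) → A) (h : boxSum e D φ = 0) : ∀ m ∈ box κ D, φ m = 0 :=
  mem_ideal_of_boxSum he hd D φ ⊥ (by simp [h])

lemma exists_boxSum (he : ∀ n, (e n).Monic) (hd : ∀ n, (e n).natDegree = n)
    (f : MvPolynomial κ A) (D₀ : ℕ) : ∃ D, D₀ ≤ D ∧ ∃ φ, (∀ m ∉ box κ D, φ m = 0) ∧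
      f = boxSum e D φ := by
  obtain ⟨D, hD, φ, h⟩ : ∃ D, D₀ ≤ D ∧ ∃ φ, f = boxSum e D φ := by
    refine ⟨max D₀ (f.totalDegree + 1), le_max_left _ _, ?_⟩
    set D := max D₀ (f.totalDegree + 1)
    have hX : ∀ k, ∃ c : ℕ → A, k < D → Polynomial.X ^ k =
        ∑ l ∈ Finset.range D, Polynomial.C (c l) * e l := fun k => by
      by_cases hk : k < D
      · obtain ⟨c, hc⟩ := exists_expansion he hd D (Polynomial.X ^ k)
          ((Polynomial.degree_X_pow_le k).trans_lt (by exact_mod_cast hk))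
        exact ⟨c, fun _ => hc⟩
      · exact ⟨0, fun h => absurd h hk⟩
    choose c hc using hX
    refine ⟨fun m => ∑ n ∈ f.support, coeff n f * ∏ i, c (n i) (m i), ?_⟩
    have hmon : ∀ n ∈ f.support, monomial n (coeff n f) =
        ∑ m ∈ box κ D, C (coeff n f * ∏ i, c (n i) (m i)) * polyProd fun i => e (m i) := by
      intro n hn
      have hnD : ∀ i, n i < D := fun i =>
        ((Finsupp.le_degree i n).trans (le_totalDegree hn)).trans_lt
          ((Nat.lt_succ_self _).trans_le (le_max_right _ _))
      have hXi : ∀ i, (X i : MvPolynomial κ A) ^ n i = ∑ l ∈ Finset.range D,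
          C (c (n i) l) * Polynomial.aeval (X i) (e l) := fun i => by
        have := congrArg (Polynomial.aeval (X i : MvPolynomial κ A)) (hc _ (hnD i))
        simpa [algebraMap_eq] using this
      rw [monomial_eq, Finsupp.prod_fintype _ _ (by simp)]
      simp only [hXi]
      rw [Finset.prod_univ_sum, Finset.mul_sum]
      refine Finset.sum_congr rfl fun m _ => ?_
      rw [Finset.prod_mul_distrib, C_mul, map_prod, mul_assoc]
      rfl
    conv_lhs => rw [f.as_sum, Finset.sum_congr rfl hmon, Finset.sum_comm]
    simp only [boxSum, map_sum, Finset.sum_mul]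
  refine ⟨D, hD, fun m => if m ∈ box κ D then φ m else 0, fun m hm => if_neg hm, ?_⟩
  rw [h, boxSum, boxSum]
  exact Finset.sum_congr rfl fun m hm => by simp only [if_pos hm]

lemma sum_box_eq {M : Type*} [AddCommMonoid M] {D : ℕ} (hD : 0 < D) (j : κ) (F : (κ → ℕ) → M) :
    ∑ m ∈ box κ D, F m = ∑ m ∈ box κ D,
      if m j = 0 then ∑ k ∈ Finset.range D, F (Function.update m j k) else 0 := by
  rw [← Finset.sum_filter, Finset.sum_sigma']
  refine Finset.sum_nbij' (fun m => ⟨Function.update m j 0, m j⟩)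
    (fun x => Function.update x.1 j x.2) ?_ ?_ ?_ ?_ ?_
  · intro m hm
    rw [Fintype.mem_piFinset] at hm
    simp only [Finset.mem_sigma, Finset.mem_filter, Fintype.mem_piFinset, Function.update_self,
      and_true]
    refine ⟨fun i => ?_, hm j⟩
    by_cases h : i = j
    · subst h; simpa using hD
    · rw [Function.update_of_ne h]; exact hm i
  · rintro ⟨m, k⟩ hm
    simp only [Finset.mem_sigma, Finset.mem_filter, Fintype.mem_piFinset] at hm
    rw [Fintype.mem_piFinset]
    intro i
    by_cases h : i = j
    · subst h; simpa using hm.2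
    · simp only [Function.update_of_ne h]; exact hm.1.1 i
  · intro m _; simp
  · rintro ⟨m, k⟩ hm
    simp only [Finset.mem_sigma, Finset.mem_filter] at hm
    simp [← hm.1.2]
  · intro m _; simp

/-- If applying an operation in the variable `y_j` multiplies products by `u (m j)` and removes
`y_j`, then it acts on coefficients by contraction with `u`. -/
lemma boxSum_contract (he0 : e 0 = 1) {D : ℕ} (hD : 0 < D) (j : κ) (φ : (κ → ℕ) → A)
    (u : ℕ → A) : ∑ m ∈ box κ D, C (φ m) * (C (u (m j)) *
        polyProd (Function.update (fun i => e (m i)) j 1)) =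
      boxSum e D fun m => if m j = 0 then
        ∑ k ∈ Finset.range D, φ (Function.update m j k) * u k else 0 := by
  rw [sum_box_eq hD j, boxSum]
  refine Finset.sum_congr rfl fun m _ => ?_
  split_ifs with h
  · rw [map_sum, Finset.sum_mul]
    refine Finset.sum_congr rfl fun k _ => ?_
    rw [Function.update_self, C_mul, mul_assoc]
    congr 3
    funext i
    by_cases hi : i = j
    · subst hi; simp [h, he0]
    · simp [Function.update_of_ne hi]
  · simp

lemma substC_boxSum (he0 : e 0 = 1) {D : ℕ} (hD : 0 < D) (j : κ) (a : A) (φ : (κ → ℕ) → A) :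
    substC j a (boxSum e D φ) = boxSum e D fun m => if m j = 0 then
      ∑ k ∈ Finset.range D, φ (Function.update m j k) * (e k).eval a else 0 := by
  rw [← boxSum_contract he0 hD j φ fun k => (e k).eval a, boxSum, map_sum]
  refine Finset.sum_congr rfl fun m _ => ?_
  rw [map_mul, substC_polyProd, ← algebraMap_eq, AlgHom.commutes]

lemma substC_pderiv_boxSum (he0 : e 0 = 1) {D : ℕ} (hD : 0 < D) (j : κ) (a : A)
    (φ : (κ → ℕ) → A) : substC j a (pderiv j (boxSum e D φ)) = boxSum e D fun m => if m j = 0 then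
      ∑ k ∈ Finset.range D, φ (Function.update m j k) * (Polynomial.derivative (e k)).eval a
      else 0 := by
  rw [← boxSum_contract he0 hD j φ fun k => (Polynomial.derivative (e k)).eval a, boxSum, map_sum,
    map_sum]
  refine Finset.sum_congr rfl fun m _ => ?_
  rw [pderiv_C_mul, pderiv_polyProd, map_mul, substC_polyProd, ← algebraMap_eq, AlgHom.commutes,
    Function.update_self, Function.update_idem]

lemma rename_boxSum (D : ℕ) (φ : (κ → ℕ) → A) (σ : Equiv.Perm κ) :
    rename σ (boxSum e D φ) = boxSum e D fun m => φ (m ∘ σ) := by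
  rw [boxSum, boxSum, map_sum]
  refine Finset.sum_nbij' (fun m => m ∘ σ.symm) (fun m => m ∘ σ) ?_ ?_ ?_ ?_ ?_
  · intro m hm; rw [Fintype.mem_piFinset] at *; exact fun i => hm _
  · intro m hm; rw [Fintype.mem_piFinset] at *; exact fun i => hm _
  · intro m _; simp [Function.comp_assoc]
  · intro m _; simp [Function.comp_assoc]
  · intro m _
    rw [map_mul, rename_C, rename_polyProd]
    simp [Function.comp_def]

lemma map_boxSum (D : ℕ) (φ : (κ → ℕ) → A) (τ : A →+* A) (hτ : ∀ n, (e n).map τ = e n) :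
    map τ (boxSum e D φ) = boxSum e D fun m => τ (φ m) := by
  rw [boxSum, boxSum, map_sum]
  refine Finset.sum_congr rfl fun m _ => ?_
  rw [map_mul, map_C, polyProd, map_prod]
  congr 1
  refine Finset.prod_congr rfl fun i _ => ?_
  conv_rhs => rw [← hτ]
  simp only [Polynomial.aeval_def, Polynomial.eval₂_map, Polynomial.hom_eval₂, map_X]
  congr 1
  ext a
  simp [algebraMap_eq]

lemma boxSum_sub (D : ℕ) (φ ψ : (κ → ℕ) → A) :
    boxSum e D φ - boxSum e D ψ = boxSum e D fun m => φ m - ψ m := by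
  simp only [boxSum, C_sub, sub_mul, Finset.sum_sub_distrib]

end PolyProd

section Polarization
variable {ω S : Type*} [Fintype ω] [DecidableEq ω] [CommRing S]

lemma sum_embedding_mem (B : Subring S) (G : Submonoid (ω → S)) (h : ∀ g ∈ G, ∑ i, g i ∈ B)
    (k : ℕ) (g : Fin k → ω → S) (hg : ∀ j, g j ∈ G) :
    ∑ φ : Fin k ↪ ω, ∏ j, g j (φ j) ∈ B := by
  induction k with
  | zero => simp [one_mem]
  | succ k ih =>
    have key : ∑ φ : Fin (k + 1) ↪ ω, ∏ j, g j (φ j) =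
        (∑ i, g 0 i) * ∑ φ : Fin k ↪ ω, ∏ j, g j.succ (φ j) -
        ∑ l : Fin k, ∑ φ : Fin k ↪ ω,
          ∏ j, (if j = l then g j.succ * g 0 else g j.succ) (φ j) := by
      rw [← Equiv.sum_comp (Equiv.embeddingFinSucc k ω).symm, Fintype.sum_sigma, Finset.mul_sum,
        Finset.sum_comm, ← Finset.sum_sub_distrib]
      refine Finset.sum_congr rfl fun φ _ => ?_
      have h1 : ∀ i : {i // i ∉ Set.range φ},
          ∏ j, g j ((Equiv.embeddingFinSucc k ω).symm ⟨φ, i⟩ j) =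
            g 0 i * ∏ j, g j.succ (φ j) := fun i => by
        rw [Fin.prod_univ_succ]
        simp [Equiv.coe_embeddingFinSucc_symm]
      have h2 : ∀ l : Fin k, ∏ j, (if j = l then g j.succ * g 0 else g j.succ) (φ j) =
          g 0 (φ l) * ∏ j, g j.succ (φ j) := fun l => by
        have : ∀ j, (if j = l then g j.succ * g 0 else g j.succ) (φ j) =
            (if j = l then g 0 (φ j) else 1) * g j.succ (φ j) := fun j => by
          split_ifs <;> simp [mul_comm]
        rw [Finset.prod_congr rfl fun j _ => this j, Finset.prod_mul_distrib,
          Finset.prod_ite_eq' Finset.univ l]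
        simp
      rw [Finset.sum_congr rfl fun i _ => h1 i, Finset.sum_congr rfl fun l _ => h2 l,
        ← Finset.sum_mul, ← Finset.sum_mul, ← sub_mul]
      congr 1
      rw [eq_sub_iff_add_eq, ← Finset.sum_map Finset.univ φ (g 0),
        ← Finset.sum_add_sum_compl (Finset.univ.map φ) (g 0), add_comm]
      congr 1
      exact (Finset.sum_subtype _ (by simp) _).symm
    rw [key]
    refine B.sub_mem (B.mul_mem (h _ (hg 0)) (ih _ fun j => hg _)) (B.sum_mem fun l _ => ih _ ?_)
    intro j
    split_ifs
    · exact mul_mem (hg _) (hg _)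
    · exact hg _

lemma sum_perm_mem (B : Subring S) (G : Submonoid (ω → S)) (h : ∀ g ∈ G, ∑ i, g i ∈ B)
    (g : ω → ω → S) (hg : ∀ j, g j ∈ G) : ∑ σ : Equiv.Perm ω, ∏ j, g j (σ j) ∈ B := by
  have h1 := sum_embedding_mem B G h _ (fun j => g ((Fintype.equivFin ω).symm j)) fun j => hg _
  convert h1 using 1
  set e := Fintype.equivFin ω
  refine Fintype.sum_bijective (fun σ : Equiv.Perm ω => e.symm.toEmbedding.trans σ.toEmbedding)
    ⟨fun σ τ h => ?_, fun φ => ?_⟩ _ _ fun σ => ?_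
  · ext i
    simpa using DFunLike.congr_fun h (e i)
  · refine ⟨(e.toEmbedding.trans φ).equivOfFiniteSelfEmbedding, ?_⟩
    ext i
    simp
  · rw [← Equiv.prod_comp e.symm]
    simp

end Polarization

section

lemma mem_survivingIndices {N k : ℕ} : k ∈ survivingIndices N ↔ k < 2 * N ∧ k ∉ Finset.Icc 1 N := by
  rw [survivingIndices, Finset.mem_filter, Finset.mem_range]

variable {ι : Type*} [Fintype ι] [DecidableEq ι]

lemma exists_coeff_choice (o : ι) : ∃ χ : MvPolynomial ι ℂ → ℕ → MvPolynomial ι ℂ,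
    (∀ t k, (χ t k).IsSymmetric) ∧ (∀ k, χ 0 k = 0) ∧
    (∀ t, ∀ k ∉ survivingIndices (Fintype.card ι), χ t k = 0) ∧
    ∀ t, (∀ τ : Equiv.Perm ι, τ o = o → rename τ t = t) →
      (∀ l, l ≠ o → (X o - X l) ^ 2 ∣ t - rename (Equiv.swap o l) t) →
      t = ∑ k ∈ survivingIndices (Fintype.card ι), χ t k * (adaptedBasis ι k).eval (X o) := by
  classical
  have h : ∀ t : MvPolynomial ι ℂ, ∃ ψ : ℕ → MvPolynomial ι ℂ, (∀ k, (ψ k).IsSymmetric) ∧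
      (t = 0 → ∀ k, ψ k = 0) ∧ (∀ k ∉ survivingIndices (Fintype.card ι), ψ k = 0) ∧
      ((∀ τ : Equiv.Perm ι, τ o = o → rename τ t = t) →
      (∀ l, l ≠ o → (X o - X l) ^ 2 ∣ t - rename (Equiv.swap o l) t) →
      t = ∑ k ∈ survivingIndices (Fintype.card ι), ψ k * (adaptedBasis ι k).eval (X o)) := by
    intro t
    by_cases ht : t ≠ 0 ∧ (∀ τ : Equiv.Perm ι, τ o = o → rename τ t = t) ∧
      ∀ l, l ≠ o → (X o - X l) ^ 2 ∣ t - rename (Equiv.swap o l) t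
    · obtain ⟨ψ, h1, h2⟩ := exists_adapted_expansion o t ht.2.1 ht.2.2
      refine ⟨fun k => if k ∈ survivingIndices (Fintype.card ι) then ψ k else 0, fun k => ?_,
        fun h => absurd h ht.1, fun k hk => if_neg hk, fun _ _ => ?_⟩
      · dsimp only
        split_ifs
        · exact h1 k
        · exact IsSymmetric.zero
      · conv_lhs => rw [h2]
        exact Finset.sum_congr rfl fun k hk => by simp only [if_pos hk]
    · refine ⟨0, fun _ => IsSymmetric.zero, fun _ _ => rfl, fun _ _ => rfl, fun h1 h2 => ?_⟩
      have : t = 0 := by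
        by_contra h0
        exact ht ⟨h0, h1, h2⟩
      simp [this]
  choose χ h1 h2 h3 h4 using h
  exact ⟨χ, h1, h2 0 rfl, h3, h4⟩

/-- If an antisymmetric combination of products of adapted basis elements vanishes at all pairs of
distinct variables, then its coefficients vanish. -/
lemma antisymm_coeff_eq_zero {o l₀ : ι} (hl₀ : l₀ ≠ o) (d : ℕ → ℕ → MvPolynomial ι ℂ)
    (hd : ∀ k k', (d k k').IsSymmetric) (hanti : ∀ k k', d k k' = -d k' k)
    (h : ∑ k ∈ survivingIndices (Fintype.card ι), ∑ k' ∈ survivingIndices (Fintype.card ι),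
      d k k' * (adaptedBasis ι k').eval (X o) * (adaptedBasis ι k).eval (X l₀) = 0) :
    ∀ k ∈ survivingIndices (Fintype.card ι), ∀ k' ∈ survivingIndices (Fintype.card ι),
      d k k' = 0 := by
  set J := survivingIndices (Fintype.card ι)
  have hab : ∀ a b : ι, ∑ k ∈ J, ∑ k' ∈ J,
      d k k' * (adaptedBasis ι k').eval (X a) * (adaptedBasis ι k).eval (X b) = 0 := by
    intro a b
    by_cases hne : b = a
    · subst hne
      rw [← self_eq_neg]
      conv_lhs => rw [Finset.sum_comm]
      rw [← Finset.sum_neg_distrib]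
      refine Finset.sum_congr rfl fun k _ => ?_
      rw [← Finset.sum_neg_distrib]
      refine Finset.sum_congr rfl fun k' _ => ?_
      rw [hanti]
      ring
    · obtain ⟨τ, ho, hl⟩ : ∃ τ : Equiv.Perm ι, τ o = a ∧ τ l₀ = b := by
        refine ⟨Equiv.swap (Equiv.swap o a l₀) b * Equiv.swap o a, ?_, ?_⟩
        · rw [Equiv.Perm.mul_apply, Equiv.swap_apply_left, Equiv.swap_apply_of_ne_of_ne]
          · intro h
            rw [eq_comm, Equiv.swap_apply_eq_iff, Equiv.swap_apply_right] at h
            exact hl₀ h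
          · exact Ne.symm hne
        · simp
      have := congrArg (rename τ) h
      simpa only [map_sum, map_mul, (adaptedBasis_hasSymmCoeffs _).eval, rename_X, ho, hl,
        hd _ _ τ, map_zero] using this
  intro k hk k' hk'
  have h1 : ∀ b, ∑ k ∈ J, d k k' * (adaptedBasis ι k).eval (X b) = 0 := fun b =>
    coeff_eq_zero_of_eval (fun k' => ∑ k ∈ J, d k k' * (adaptedBasis ι k).eval (X b)) (fun a => by
      rw [← hab a b, Finset.sum_comm]
      refine Finset.sum_congr rfl fun k _ => ?_
      rw [Finset.sum_mul]
      exact Finset.sum_congr rfl fun k' _ => by ring) k' hk'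
  exact coeff_eq_zero_of_eval (fun k => d k k') h1 k hk

variable {κ : Type*} [Fintype κ] [DecidableEq κ]

/-- The action of a permutation on the coefficients. -/
noncomputable abbrev coeffPerm (κ : Type*) (τ : Equiv.Perm ι) :
    MvPolynomial κ (MvPolynomial ι ℂ) →+* MvPolynomial κ (MvPolynomial ι ℂ) :=
  map (rename τ : MvPolynomial ι ℂ →ₐ[ℂ] MvPolynomial ι ℂ).toRingHom

/-- The quasi-invariance conditions, with `f` viewed as a polynomial in the variables indexed by
`κ` over the polynomials in the variables indexed by `ι`. -/
structure IsQuasiInvariant (o l₀ : ι) (j₀ : κ) (f : MvPolynomial κ (MvPolynomial ι ℂ)) : Prop where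
  rename_eq : ∀ σ : Equiv.Perm κ, rename σ f = f
  coeffPerm_eq : ∀ τ : Equiv.Perm ι, τ o = o → coeffPerm κ τ f = f
  exchange : coeffPerm κ (Equiv.swap o l₀) (substC j₀ (X l₀) f) = substC j₀ (X l₀) f
  pderiv_eq : ∀ l, substC j₀ (X l) (pderiv j₀ f) = 0
  dvd : ∀ l, l ≠ o → C ((X o - X l) ^ 2) ∣ f - coeffPerm κ (Equiv.swap o l) f

lemma IsQuasiInvariant.exists_coeff {o l₀ : ι} (hl₀ : l₀ ≠ o) {j₀ : κ}
    {f : MvPolynomial κ (MvPolynomial ι ℂ)} (hf : IsQuasiInvariant o l₀ j₀ f) :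
    ∃ D, 2 * Fintype.card ι ≤ D ∧ ∃ ψ : ℕ → (κ → ℕ) → MvPolynomial ι ℂ,
      (∀ k m, (ψ k m).IsSymmetric) ∧
      (∀ k ∉ survivingIndices (Fintype.card ι), ∀ m, ψ k m = 0) ∧
      (∀ k m j, m j ∈ Finset.Icc 1 (Fintype.card ι) → ψ k m = 0) ∧
      (∀ k m (σ : Equiv.Perm κ), ψ k (m ∘ σ) = ψ k m) ∧
      (∀ k ∈ survivingIndices (Fintype.card ι), ∀ k' ∈ survivingIndices (Fintype.card ι), ∀ m j,
        ψ k' (Function.update m j k) = ψ k (Function.update m j k')) ∧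
      f = boxSum (adaptedBasis ι) D fun m => ∑ k ∈ survivingIndices (Fintype.card ι),
        ψ k m * (adaptedBasis ι k).eval (X o) := by
  set N := Fintype.card ι with hN
  have hNpos : 0 < N := Fintype.card_pos_iff.2 ⟨o⟩
  have : Nonempty ι := ⟨o⟩
  have he := fun n => (adaptedBasis_monic_and_natDegree (ι := ι) n).1
  have hd := fun n => (adaptedBasis_monic_and_natDegree (ι := ι) n).2
  obtain ⟨D, hD, φ, hφ0, hφ⟩ := exists_boxSum he hd f (2 * N)
  have hD0 : 0 < D := by omega
  obtain ⟨χ, hχs, hχ0, hχJ, hχ⟩ := exists_coeff_choice o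
  have hφσ : ∀ m (σ : Equiv.Perm κ), φ (m ∘ σ) = φ m := by
    intro m σ
    by_cases hm : m ∈ box κ D
    · have h := hf.rename_eq σ
      rw [hφ, rename_boxSum, ← sub_eq_zero, boxSum_sub] at h
      exact sub_eq_zero.1 (eq_zero_of_boxSum he hd D _ h m hm)
    · rw [hφ0 m hm, hφ0]
      contrapose! hm
      rw [Fintype.mem_piFinset] at hm ⊢
      exact fun i => by simpa using hm (σ.symm i)
  have hφτ : ∀ m (τ : Equiv.Perm ι), τ o = o → rename τ (φ m) = φ m := by
    intro m τ hτ
    by_cases hm : m ∈ box κ D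
    · have h := hf.coeffPerm_eq τ hτ
      rw [hφ, coeffPerm, map_boxSum _ _ _ fun n => adaptedBasis_hasSymmCoeffs n τ,
        ← sub_eq_zero, boxSum_sub] at h
      exact sub_eq_zero.1 (eq_zero_of_boxSum he hd D _ h m hm)
    · rw [hφ0 m hm, map_zero]
  have hφdvd : ∀ m l, l ≠ o → (X o - X l) ^ 2 ∣ φ m - rename (Equiv.swap o l) (φ m) := by
    intro m l hl
    by_cases hm : m ∈ box κ D
    · have h := hf.dvd l hl
      rw [hφ, coeffPerm, map_boxSum _ _ _ fun n => adaptedBasis_hasSymmCoeffs n _,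
        boxSum_sub, C_dvd_iff_dvd_coeff] at h
      exact Ideal.mem_span_singleton.1
        (mem_ideal_of_boxSum he hd D _ _ (fun n => Ideal.mem_span_singleton.2 (h n)) m hm)
    · rw [hφ0 m hm, map_zero, sub_zero]
      exact dvd_zero _
  have hφχ := fun m => hχ (φ m) (hφτ m) (hφdvd m)
  have hupd : ∀ m ∈ box κ D, ∀ j, ∀ k < D, Function.update m j k ∈ box κ D := by
    intro m hm j k hk
    rw [Fintype.mem_piFinset] at hm ⊢
    intro i
    by_cases hi : i = j
    · subst hi; simpa using hk
    · rw [Function.update_of_ne hi]; exact hm i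
  have hbad₀ : ∀ m, m j₀ ∈ Finset.Icc 1 N → φ m = 0 := by
    intro m hm
    by_cases hmD : m ∈ box κ D
    · have h : ∀ a, ∑ k ∈ Finset.range D, φ (Function.update m j₀ k) *
          (Polynomial.derivative (adaptedBasis ι k)).eval (X a) = 0 := fun a => by
        have h1 := hf.pderiv_eq a
        rw [hφ, substC_pderiv_boxSum adaptedBasis_zero hD0] at h1
        simpa using eq_zero_of_boxSum he hd D _ h1 (Function.update m j₀ 0) (hupd m hmD _ _ hD0)
      simpa using coeff_eq_zero_of_derivative D _ h (m j₀)
        (Finset.mem_range.1 (Fintype.mem_piFinset.1 hmD j₀)) hm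
    · exact hφ0 m hmD
  have hbad : ∀ m j, m j ∈ Finset.Icc 1 N → φ m = 0 := by
    intro m j hm
    rw [← hφσ m (Equiv.swap j₀ j)]
    exact hbad₀ _ (by simpa using hm)
  have hsub : survivingIndices N ⊆ Finset.range D := fun k hk =>
    Finset.mem_range.2 (by have := (mem_survivingIndices.1 hk).1; omega)
  have hex₀ : ∀ k ∈ survivingIndices N, ∀ k' ∈ survivingIndices N, ∀ m,
      χ (φ (Function.update m j₀ k)) k' = χ (φ (Function.update m j₀ k')) k := by
    intro k hk k' hk' m
    by_cases hm : Function.update m j₀ 0 ∈ box κ D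
    · have h1 := hf.exchange
      rw [hφ, substC_boxSum adaptedBasis_zero hD0, coeffPerm,
        map_boxSum _ _ _ fun n => adaptedBasis_hasSymmCoeffs n _, ← sub_eq_zero, boxSum_sub] at h1
      have h2 := eq_zero_of_boxSum he hd D _ h1 _ hm
      simp only [Function.update_self, Function.update_idem, if_true] at h2
      have h3 : ∑ k ∈ Finset.range D,
          φ (Function.update m j₀ k) * (adaptedBasis ι k).eval (X l₀) =
          ∑ k ∈ survivingIndices N, ∑ k' ∈ survivingIndices N,
            χ (φ (Function.update m j₀ k)) k' * (adaptedBasis ι k').eval (X o) *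
              (adaptedBasis ι k).eval (X l₀) := by
        rw [← Finset.sum_subset hsub fun k _ hk => ?_]
        · refine Finset.sum_congr rfl fun k _ => ?_
          rw [← Finset.sum_mul, ← hφχ]
        · rw [mem_survivingIndices, not_and_or, not_lt, not_not] at hk
          rcases hk with hk | hk
          · rw [adaptedBasis_eval_eq_zero hk, mul_zero]
          · rw [hbad₀ _ (by simpa using hk), zero_mul]
      rw [h3] at h2
      refine sub_eq_zero.1 (antisymm_coeff_eq_zero hl₀ (fun k k' =>
        χ (φ (Function.update m j₀ k)) k' - χ (φ (Function.update m j₀ k')) k)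
        (fun _ _ => (hχs _ _).sub (hχs _ _)) (fun _ _ => (neg_sub _ _).symm) ?_ k hk k' hk')
      simp only [sub_mul, Finset.sum_sub_distrib]
      rw [← neg_eq_zero, neg_sub, ← h2]
      congr 1
      simp only [AlgHom.toRingHom_eq_coe, RingHom.coe_coe, map_sum, map_mul, hχs _ _ _,
        (adaptedBasis_hasSymmCoeffs _).eval, rename_X, Equiv.swap_apply_left,
        Equiv.swap_apply_right]
      rw [Finset.sum_comm]
      exact Finset.sum_congr rfl fun k _ => Finset.sum_congr rfl fun k' _ => by ring
    · have h0 : ∀ k, Function.update m j₀ k ∉ box κ D := fun k hk => hm (by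
        simpa using hupd _ hk j₀ 0 hD0)
      rw [hφ0 _ (h0 k), hφ0 _ (h0 k'), hχ0, hχ0]
  refine ⟨D, hD, fun k m => χ (φ m) k, fun k m => hχs _ _, fun k hk m => hχJ _ _ hk,
    fun k m j hm => by simp only [hbad m j hm, hχ0], fun k m σ => by simp only [hφσ],
    fun k hk k' hk' m j => ?_, ?_⟩
  · have h1 : ∀ k, φ (Function.update m j k) =
        φ (Function.update (m ∘ Equiv.swap j₀ j) j₀ k) := fun k => by
      rw [← hφσ _ (Equiv.swap j₀ j)]
      congr 1
      funext i
      by_cases hi : i = j₀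
      · subst hi; simp
      · have : Equiv.swap j₀ j i ≠ j := by
          rw [Ne, Equiv.swap_apply_eq_iff, Equiv.swap_apply_right]; exact hi
        simp [Function.update_of_ne hi, Function.update_of_ne this]
    simp only [h1]
    exact hex₀ k hk k' hk' _
  · rw [hφ]
    congr 1
    funext m
    exact hφχ m

end

section

variable {ι : Type*} [Fintype ι] [DecidableEq ι] {κ : Type*} [Fintype κ] [DecidableEq κ]

lemma sum_box_option {M : Type*} [AddCommMonoid M] (D : ℕ) (F : (Option κ → ℕ) → M) :
    ∑ μ ∈ box (Option κ) D, F μ =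
      ∑ m ∈ box κ D, ∑ k ∈ Finset.range D, F fun i => i.elim k m := by
  rw [← Finset.sum_product']
  refine Finset.sum_nbij' (fun μ => (μ ∘ some, μ none)) (fun x i => i.elim x.2 x.1) ?_ ?_ ?_ ?_ ?_
  · intro μ hμ
    rw [Fintype.mem_piFinset] at hμ
    exact Finset.mem_product.2 ⟨Fintype.mem_piFinset.2 fun i => hμ _, hμ _⟩
  · intro x hx
    rw [Finset.mem_product, Fintype.mem_piFinset] at hx
    rw [Fintype.mem_piFinset]
    rintro (_ | i)
    · exact hx.2
    · exact hx.1 i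
  · intro μ _
    funext i
    cases i <;> rfl
  · intro x _; rfl
  · intro μ _
    congr 1
    funext i
    cases i <;> rfl

/-- Symmetrisation of a linear combination whose coefficients are invariant as long as a
predicate is satisfied. -/
lemma sum_box_symmetrize {ω S : Type*} [Fintype ω] [DecidableEq ω] [CommRing S] [Algebra ℂ S]
    (D : ℕ) (A β : (ω → ℕ) → S) (p : (ω → ℕ) → Prop) [DecidablePred p]
    (hA : ∀ μ, ¬ p μ → A μ = 0)
    (hAp : ∀ μ (σ : Equiv.Perm ω), p μ → p (μ ∘ σ) → A (μ ∘ σ) = A μ)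
    (hβ : ∀ μ, ¬ p μ → (∀ σ : Equiv.Perm ω, A (μ ∘ σ) = 0) ∨ β μ = 0) :
    ∑ μ ∈ box ω D, A μ * β μ = ∑ μ ∈ box ω D,
      (1 / ((Finset.univ.filter fun σ : Equiv.Perm ω => p (μ ∘ σ)).card : ℂ)) • A μ *
        ∑ σ : Equiv.Perm ω, β (μ ∘ σ) := by
  set c : (ω → ℕ) → ℕ := fun μ => (Finset.univ.filter fun σ : Equiv.Perm ω => p (μ ∘ σ)).card
  have hc : ∀ μ (σ : Equiv.Perm ω), c (μ ∘ σ) = c μ := fun μ σ =>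
    Finset.card_bij' (fun τ _ => σ * τ) (fun τ _ => σ⁻¹ * τ)
      (by intro τ hτ; simpa [Function.comp_assoc] using hτ)
      (by
        intro τ hτ
        rw [Finset.mem_filter] at hτ ⊢
        refine ⟨Finset.mem_univ _, ?_⟩
        rw [Function.comp_assoc, ← Equiv.Perm.coe_mul, mul_inv_cancel_left]
        exact hτ.2)
      (by simp) (by simp)
  have h1 : ∀ σ : Equiv.Perm ω, ∑ μ ∈ box ω D, (1 / (c μ : ℂ)) • A μ * β (μ ∘ σ) =
      ∑ μ ∈ box ω D, (1 / (c μ : ℂ)) • A (μ ∘ σ.symm) * β μ := fun σ => by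
    refine Finset.sum_nbij' (fun μ => μ ∘ σ) (fun μ => μ ∘ σ.symm) ?_ ?_ ?_ ?_ ?_
    · intro m hm; rw [Fintype.mem_piFinset] at *; exact fun i => hm _
    · intro m hm; rw [Fintype.mem_piFinset] at *; exact fun i => hm _
    · intro m _; simp [Function.comp_assoc]
    · intro m _; simp [Function.comp_assoc]
    · intro μ _
      rw [hc, Function.comp_assoc]
      simp
  simp only [Finset.mul_sum]
  rw [Finset.sum_comm, Finset.sum_congr rfl fun σ _ => h1 σ, Finset.sum_comm]
  refine Finset.sum_congr rfl fun μ _ => ?_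
  rw [← Equiv.sum_comp (Equiv.inv (Equiv.Perm ω))]
  simp only [Equiv.inv_apply, Equiv.Perm.inv_def, Equiv.symm_symm]
  rw [← Finset.sum_mul, ← Finset.smul_sum]
  by_cases hp : p μ
  · congr 1
    rw [← Finset.sum_filter_add_sum_filter_not _ fun σ : Equiv.Perm ω => p (μ ∘ σ)]
    rw [Finset.sum_congr rfl fun σ hσ => hAp μ σ hp (Finset.mem_filter.1 hσ).2,
      Finset.sum_eq_zero (s := Finset.univ.filter fun σ : Equiv.Perm ω => ¬ p (μ ∘ σ))
        fun σ hσ => hA _ (Finset.mem_filter.1 hσ).2, add_zero, Finset.sum_const,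
      ← Nat.cast_smul_eq_nsmul ℂ, smul_smul, one_div_mul_cancel, one_smul]
    have : c μ ≠ 0 := Finset.card_ne_zero_of_mem (a := 1) (by simpa using hp)
    exact_mod_cast this
  · rcases hβ μ hp with h | h
    · simp [hA μ hp, h]
    · simp [h]

theorem IsQuasiInvariant.mem {o l₀ : ι} (hl₀ : l₀ ≠ o) {j₀ : κ}
    {f : MvPolynomial κ (MvPolynomial ι ℂ)} (hf : IsQuasiInvariant o l₀ j₀ f)
    (B : Subring (MvPolynomial κ (MvPolynomial ι ℂ)))
    (hB : ∀ k : MvPolynomial ι ℂ, k.IsSymmetric → C k ∈ B)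
    (hB' : ∀ g : Polynomial (MvPolynomial ι ℂ), HasSymmCoeffs g →
      rootPoly ι ∣ Polynomial.derivative g →
      C (g.eval (X o)) + ∑ j, Polynomial.aeval (X j) g ∈ B) : f ∈ B := by
  obtain ⟨D, hD, ψ, hψs, hψJ, hψbad, hψσ, hψex, rfl⟩ := hf.exists_coeff hl₀
  have : Nonempty ι := ⟨o⟩
  set N := Fintype.card ι
  let w : Option κ → MvPolynomial κ (MvPolynomial ι ℂ) := fun i => i.elim (C (X o)) X
  have hw : ∀ g, Polynomial.aeval (w none) g = C (g.eval (X o)) := fun g => by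
    rw [← Polynomial.coe_aeval_eq_eval, ← algebraMap_eq, ← Polynomial.aeval_algebraMap_apply]
    rfl
  let β : (Option κ → ℕ) → MvPolynomial κ (MvPolynomial ι ℂ) := fun μ =>
    ∏ i, Polynomial.aeval (w i) (adaptedBasis ι (μ i))
  let A : (Option κ → ℕ) → MvPolynomial ι ℂ := fun μ => ψ (μ none) (μ ∘ some)
  have hf' : boxSum (adaptedBasis ι) D (fun m => ∑ k ∈ survivingIndices N,
      ψ k m * (adaptedBasis ι k).eval (X o)) = ∑ μ ∈ box (Option κ) D, C (A μ) * β μ := by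
    rw [sum_box_option, boxSum]
    refine Finset.sum_congr rfl fun m _ => ?_
    rw [Finset.sum_subset (fun k hk => Finset.mem_range.2
      (((mem_survivingIndices.1 hk).1).trans_le hD)) fun k _ hk => by rw [hψJ k hk, zero_mul],
      map_sum, Finset.sum_mul]
    refine Finset.sum_congr rfl fun k _ => ?_
    have hβ : β (fun i => i.elim k m) = C ((adaptedBasis ι k).eval (X o)) *
        polyProd fun i => adaptedBasis ι (m i) := by
      simp only [β]
      rw [Fintype.prod_option, hw]
      rfl
    rw [hβ, C_mul, mul_assoc]
    rfl
  rw [hf', sum_box_symmetrize D (fun μ => C (A μ)) β (fun μ => μ none ∈ survivingIndices N)]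
  · refine B.sum_mem fun μ _ => ?_
    by_cases hA0 : A μ = 0
    · simp [hA0]
    refine B.mul_mem ?_ ?_
    · rw [show ∀ (c : ℂ) (k : MvPolynomial ι ℂ), c • (C k : MvPolynomial κ (MvPolynomial ι ℂ)) =
        C (c • k) from fun c k => (map_smul (IsScalarTower.toAlgHom ℂ _ _) c k).symm]
      exact hB _ ((hψs _ _).smul _)
    have hμ : ∀ i, μ i ∉ Finset.Icc 1 N := by
      rintro (_ | j) hi
      · exact hA0 (hψJ _ (fun h => (mem_survivingIndices.1 h).2 hi) _)
      · exact hA0 (hψbad _ _ j hi)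
    let G : Submonoid (Option κ → MvPolynomial κ (MvPolynomial ι ℂ)) :=
      { carrier := {v | ∃ g, HasSymmCoeffs g ∧ rootPoly ι ∣ Polynomial.derivative g ∧
          v = fun i => Polynomial.aeval (w i) g}
        one_mem' := ⟨1, (symmCoeffSubring ι).one_mem, by simp, by funext i; simp⟩
        mul_mem' := by
          rintro _ _ ⟨g, hg, hg', rfl⟩ ⟨h, hh, hh', rfl⟩
          refine ⟨g * h, (symmCoeffSubring ι).mul_mem hg hh, ?_, by funext i; simp⟩
          rw [Polynomial.derivative_mul]
          exact dvd_add (hg'.mul_right _) (hh'.mul_left _) }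
    have h := sum_perm_mem B G (fun v hv => by
      obtain ⟨g, hg, hg', rfl⟩ := hv
      rw [Fintype.sum_option, hw]
      exact hB' g hg hg') (fun i j => Polynomial.aeval (w j) (adaptedBasis ι (μ i))) fun i =>
        ⟨_, adaptedBasis_hasSymmCoeffs _, rootPoly_dvd_derivative_adaptedBasis (hμ i), rfl⟩
    convert h using 1
    rw [← Equiv.sum_comp (Equiv.inv (Equiv.Perm (Option κ)))]
    refine Finset.sum_congr rfl fun σ _ => ?_
    simp only [β]
    rw [← Equiv.prod_comp σ]
    simp
  · intro μ hμ
    simp only [A, hψJ _ hμ, C_0]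
  · intro μ σ h h'
    obtain ⟨⟨i, ρ⟩, rfl⟩ := Equiv.Perm.decomposeOption.symm.surjective σ
    refine congrArg C ?_
    simp only [A]
    rw [Equiv.Perm.decomposeOption_symm_apply] at h' ⊢
    cases i with
    | none =>
      rw [← hψσ (μ none) (μ ∘ some) ρ]
      congr 1
    | some j =>
      have h2 : (μ ∘ (Equiv.swap none (some j) * ρ.optionCongr)) ∘ some =
          Function.update (μ ∘ some) j (μ none) ∘ ρ := by
        funext x
        by_cases hx : ρ x = j
        · simp [hx]
        · simp [Function.update_of_ne hx, Equiv.swap_apply_of_ne_of_ne (a := none) (b := some j)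
            (x := some (ρ x)) (by simp) (by simpa using hx)]
      have h3 : (μ ∘ (Equiv.swap none (some j) * ρ.optionCongr)) none = μ (some j) := by simp
      rw [h3] at h' ⊢
      rw [h2, hψσ, hψex _ h _ h']
      congr 1
      exact Function.update_eq_self j (μ ∘ some)
  · intro μ hμ
    have hμ' := hμ
    rw [mem_survivingIndices, not_and_or, not_lt, not_not] at hμ
    rcases hμ with hμ | hμ
    · right
      exact Finset.prod_eq_zero (Finset.mem_univ none) (by
        rw [hw, adaptedBasis_eval_eq_zero hμ, C_0])
    · left
      intro σ
      simp only [A]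
      rcases hσ : σ.symm none with _ | j
      · rw [hψJ, C_0]
        rw [Function.comp_apply, (Equiv.symm_apply_eq σ).1 hσ |>.symm]
        exact hμ'
      · rw [hψbad _ _ j, C_0]
        rw [Function.comp_apply, Function.comp_apply, (Equiv.symm_apply_eq σ).1 hσ |>.symm]
        exact hμ

end

section Limit
variable {S : Type*} [CommRing S]

lemma coeff_zero_affine_mul (z y : S) (F : Polynomial S) :
    ((Polynomial.C z + Polynomial.X * Polynomial.C y) * F).coeff 0 = z * F.coeff 0 := by
  simp [Polynomial.mul_coeff_zero]

lemma coeff_one_affine_mul (z y : S) (F : Polynomial S) :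
    ((Polynomial.C z + Polynomial.X * Polynomial.C y) * F).coeff 1 =
      z * F.coeff 1 + y * F.coeff 0 := by
  rw [add_mul, mul_assoc, Polynomial.coeff_add, Polynomial.coeff_C_mul, Polynomial.coeff_X_mul,
    Polynomial.coeff_C_mul]

variable [Algebra ℂ S]

/-- Polynomial families with members in the given subalgebras, away from zero. -/
noncomputable def liftSubalgebra (𝒮 : ℂ → Subalgebra ℂ S) : Subalgebra ℂ (Polynomial S) :=
  ⨅ a : {a : ℂ // a ≠ 0}, (𝒮 a).comap
    ((Polynomial.aeval (algebraMap ℂ S a) : Polynomial S →ₐ[S] S).restrictScalars ℂ)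

lemma mem_liftSubalgebra {𝒮 : ℂ → Subalgebra ℂ S} {F : Polynomial S} :
    F ∈ liftSubalgebra 𝒮 ↔ ∀ a : ℂ, a ≠ 0 → F.eval (algebraMap ℂ S a) ∈ 𝒮 a := by
  simp [liftSubalgebra, Algebra.mem_iInf, Polynomial.coe_aeval_eq_eval]

/-- The limits at zero of polynomial families with members in the given subalgebras. -/
noncomputable def limitSubalgebra (𝒮 : ℂ → Subalgebra ℂ S) : Subalgebra ℂ S :=
  (liftSubalgebra 𝒮).map ((Polynomial.aeval (0 : S) : Polynomial S →ₐ[S] S).restrictScalars ℂ)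

lemma mem_limitSubalgebra {𝒮 : ℂ → Subalgebra ℂ S} {v : S} :
    v ∈ limitSubalgebra 𝒮 ↔ ∃ F ∈ liftSubalgebra 𝒮, F.coeff 0 = v := by
  simp [limitSubalgebra, Subalgebra.mem_map, Polynomial.coe_aeval_eq_eval,
    Polynomial.coeff_zero_eq_eval_zero]

lemma coeff_one_mem_limitSubalgebra {𝒮 : ℂ → Subalgebra ℂ S} {F : Polynomial S}
    (hF : F ∈ liftSubalgebra 𝒮) (h0 : F.coeff 0 = 0) : F.coeff 1 ∈ limitSubalgebra 𝒮 := by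
  obtain ⟨G, rfl⟩ := Polynomial.X_dvd_iff.2 h0
  refine mem_limitSubalgebra.2 ⟨G, mem_liftSubalgebra.2 fun a ha => ?_, by
    simp [Polynomial.coeff_X_mul]⟩
  have h := (𝒮 a).smul_mem (mem_liftSubalgebra.1 hF a ha) a⁻¹
  rwa [Polynomial.eval_mul, Polynomial.eval_X, ← Algebra.smul_def, smul_smul, inv_mul_cancel₀ ha,
    one_smul] at h

lemma affine_mem_liftSubalgebra {𝒮 : ℂ → Subalgebra ℂ S} {z y : S}
    (h : ∀ a : ℂ, z + a • y ∈ 𝒮 a) :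
    Polynomial.C z + Polynomial.X * Polynomial.C y ∈ liftSubalgebra 𝒮 :=
  mem_liftSubalgebra.2 fun a _ => by
    have := h a
    rw [Algebra.smul_def, mul_comm] at this
    simpa using this

end Limit

section Recurrence
variable {ι κ : Type*} [Fintype κ]

/-- The sum of the values of a polynomial at `x` and at the `y_j`. -/
noncomputable def pairSum (κ : Type*) [Fintype κ] (o : ι) :
    Polynomial (MvPolynomial ι ℂ) →ₗ[MvPolynomial ι ℂ] MvPolynomial κ (MvPolynomial ι ℂ) :=
  (Polynomial.aeval (C (X o))).toLinearMap + ∑ j, (Polynomial.aeval (X j)).toLinearMap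

lemma pairSum_apply (o : ι) (g : Polynomial (MvPolynomial ι ℂ)) :
    pairSum κ o g = C (g.eval (X o)) + ∑ j, Polynomial.aeval (X j) g := by
  rw [← Polynomial.coe_aeval_eq_eval, ← algebraMap_eq, ← Polynomial.aeval_algebraMap_apply]
  simp [pairSum, algebraMap_eq]

lemma pairSum_C_mul (o : ι) (k : MvPolynomial ι ℂ) (g : Polynomial (MvPolynomial ι ℂ)) :
    pairSum κ o (Polynomial.C k * g) = C k * pairSum κ o g := by
  rw [← Polynomial.smul_eq_C_mul, map_smul, smul_eq_C_mul]

variable [Fintype ι]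

lemma mul_signedEsymm (n : ℕ) : C (n : ℂ) * signedEsymm ι n =
    -∑ j ∈ Finset.range n, signedEsymm ι j * psum ι ℂ (n - j) := by
  classical
  have h := mul_esymm_eq_sum ι ℂ n
  rw [Finset.sum_filter, Finset.Nat.sum_antidiagonal_eq_sum_range_succ
    (fun i j => if i < n then (-1) ^ i * esymm ι ℂ i * psum ι ℂ j else 0),
    Finset.sum_range_succ, if_neg (lt_irrefl n), add_zero] at h
  rw [signedEsymm, mul_left_comm, map_natCast, h, ← mul_assoc, ← pow_add,
    Odd.neg_one_pow ⟨n, by ring⟩, neg_one_mul]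
  congr 1
  exact Finset.sum_congr rfl fun j hj => by rw [if_pos (Finset.mem_range.1 hj), signedEsymm]

lemma coeff_rootPrimitive (n m : ℕ) : (rootPrimitive ι n).coeff m =
    if 1 ≤ m ∧ m ≤ n then signedEsymm ι (n - m) * C (1 / (m : ℂ)) else 0 := by
  rw [rootPrimitive, Polynomial.finsetSum_coeff]
  simp only [Polynomial.coeff_C_mul, Polynomial.coeff_X_pow, mul_ite, mul_one, mul_zero]
  split_ifs with h
  · rw [Finset.sum_eq_single (n - m)]
    · rw [if_pos (by omega), Nat.sub_sub_self h.2]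
    · intro j hj hne
      rw [Finset.mem_range] at hj
      exact if_neg (by omega)
    · intro hn
      exact absurd (Finset.mem_range.2 (by omega)) hn
  · refine Finset.sum_eq_zero fun j hj => if_neg ?_
    rw [Finset.mem_range] at hj
    omega

lemma mul_rootPrimitive (n : ℕ) : Polynomial.C (C (n : ℂ)) * rootPrimitive ι n =
    ∑ j ∈ Finset.range n, (Polynomial.C (signedEsymm ι j) * Polynomial.X ^ (n - j) -
      Polynomial.C (psum ι ℂ (n - j)) * rootPrimitive ι j) := by
  ext1 m
  simp only [Polynomial.finsetSum_coeff, Polynomial.coeff_sub, Polynomial.coeff_C_mul,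
    Polynomial.coeff_X_pow, coeff_rootPrimitive, Finset.sum_sub_distrib]
  by_cases hm : 1 ≤ m ∧ m ≤ n
  · have hm0 : (m : ℂ) ≠ 0 := by exact_mod_cast (by omega : m ≠ 0)
    rw [if_pos hm, Finset.sum_eq_single (n - m)]
    · have h : ∑ j ∈ Finset.range n, psum ι ℂ (n - j) *
          (if 1 ≤ m ∧ m ≤ j then signedEsymm ι (j - m) * C (1 / (m : ℂ)) else 0) =
          -(C ((n - m : ℕ) : ℂ) * signedEsymm ι (n - m)) * C (1 / (m : ℂ)) := by
        rw [mul_signedEsymm, neg_neg, Finset.sum_mul, ← Finset.sum_subset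
          (s₁ := (Finset.range (n - m)).map (addRightEmbedding m))]
        · rw [Finset.sum_map]
          refine Finset.sum_congr rfl fun j _ => ?_
          rw [addRightEmbedding_apply, if_pos (by omega), Nat.add_sub_cancel,
            show n - (j + m) = n - m - j by omega]
          ring
        · intro j hj
          simp only [Finset.mem_map, Finset.mem_range, addRightEmbedding_apply] at hj ⊢
          omega
        · intro j hj hj'
          rw [if_neg, mul_zero]
          intro hc
          refine hj' (Finset.mem_map.2 ⟨j - m, ?_, ?_⟩)
          · rw [Finset.mem_range] at *; omega
          · simp [hc.2]
      rw [h, if_pos (by omega), Nat.cast_sub hm.2, C_sub]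
      have h2 : (C (m : ℂ) * C (1 / (m : ℂ)) : MvPolynomial ι ℂ) = 1 := by
        rw [← C_mul, mul_one_div_cancel hm0, C_1]
      linear_combination (signedEsymm ι (n - m)) * h2
    · intro j hj hne
      rw [Finset.mem_range] at hj
      rw [if_neg (by omega), mul_zero]
    · intro hn
      exact absurd (Finset.mem_range.2 (by omega)) hn
  · rw [if_neg hm, mul_zero, Finset.sum_eq_zero, Finset.sum_eq_zero, sub_zero]
    · intro j hj
      rw [Finset.mem_range] at hj
      rw [if_neg (by omega), mul_zero]
    · intro j hj
      rw [Finset.mem_range] at hj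
      rw [if_neg (by omega), mul_zero]

lemma exists_sum_rootPrimitive {g : Polynomial (MvPolynomial ι ℂ)} (hg : HasSymmCoeffs g)
    (hd : rootPoly ι ∣ Polynomial.derivative g) : ∃ (k : MvPolynomial ι ℂ)
      (h : ℕ → MvPolynomial ι ℂ) (D : ℕ), k.IsSymmetric ∧ (∀ n, (h n).IsSymmetric) ∧
      g = Polynomial.C k + ∑ n ∈ Finset.range D,
        Polynomial.C (h n) * rootPrimitive ι (Fintype.card ι + 1 + n) := by
  obtain ⟨h, hh⟩ := hd
  have hhs : HasSymmCoeffs h := fun τ => by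
    have h1 := hg.derivative τ
    rw [hh, Polynomial.map_mul, rootPoly_hasSymmCoeffs τ] at h1
    exact mul_left_cancel₀ rootPoly_monic.ne_zero h1
  set q := ∑ n ∈ Finset.range (h.natDegree + 1),
        Polynomial.C (h.coeff n) * rootPrimitive ι (Fintype.card ι + 1 + n) with hq
  have hq' : Polynomial.derivative q = rootPoly ι * h := by
    conv_rhs => rw [h.as_sum_range_C_mul_X_pow, Finset.mul_sum]
    rw [hq, Polynomial.derivative_sum]
    refine Finset.sum_congr rfl fun n _ => ?_
    rw [Polynomial.derivative_C_mul, derivative_rootPrimitive (by omega),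
      show Fintype.card ι + 1 + n - Fintype.card ι - 1 = n by omega]
    ring
  have hq0 : q.coeff 0 = 0 := by
    rw [hq, Polynomial.finsetSum_coeff]
    exact Finset.sum_eq_zero fun n _ => by simp [coeff_rootPrimitive]
  refine ⟨g.coeff 0, h.coeff, h.natDegree + 1, hg.coeff 0, hhs.coeff, ?_⟩
  have h0 : Polynomial.derivative (g - q) = 0 := by
    rw [Polynomial.derivative_sub, hh, hq', sub_self]
  have h1 := Polynomial.eq_C_of_natDegree_eq_zero
    (Polynomial.derivative_eq_zero.1 h0)
  rw [Polynomial.coeff_sub, hq0, sub_zero] at h1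
  rw [← h1, sub_add_cancel]

variable {𝒮 : ℂ → Subalgebra ℂ (MvPolynomial κ (MvPolynomial ι ℂ))} {o : ι}

lemma exists_lift_signedEsymm
    (h𝒮 : ∀ a, ∀ i, 1 ≤ i → C (psum ι ℂ i) + a • pairSum κ o (Polynomial.X ^ i) ∈ 𝒮 a) (n : ℕ) :
    ∃ F ∈ liftSubalgebra 𝒮, F.coeff 0 = C (signedEsymm ι n) ∧
      F.coeff 1 = -pairSum κ o (rootPrimitive ι n) := by
  induction n using Nat.strong_induction_on with
  | _ n ih =>
    rcases Nat.eq_zero_or_pos n with rfl | hn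
    · exact ⟨1, one_mem _, by simp [signedEsymm_zero], by
        simp [rootPrimitive, Polynomial.coeff_one]⟩
    have hn0 : (n : ℂ) ≠ 0 := by exact_mod_cast hn.ne'
    have ih' : ∀ j, ∃ F : Polynomial (MvPolynomial κ (MvPolynomial ι ℂ)), j < n →
        F ∈ liftSubalgebra 𝒮 ∧ F.coeff 0 = C (signedEsymm ι j) ∧
        F.coeff 1 = -pairSum κ o (rootPrimitive ι j) := fun j => by
      by_cases hj : j < n
      · obtain ⟨F, h⟩ := ih j hj
        exact ⟨F, fun _ => h⟩
      · exact ⟨0, fun h => absurd h hj⟩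
    choose F hF using ih'
    have hC : ∀ (c : ℂ) (v : MvPolynomial κ (MvPolynomial ι ℂ)), c • v = C (C c) * v := by
      intro c v
      rw [Algebra.smul_def]; rfl
    have hcancel :
        (C (C (1 / (n : ℂ))) * C (C (n : ℂ)) : MvPolynomial κ (MvPolynomial ι ℂ)) = 1 := by
      rw [← C_mul, ← C_mul, one_div_mul_cancel hn0, C_1, C_1]
    refine ⟨(-(1 / (n : ℂ))) • ∑ j ∈ Finset.range n, (Polynomial.C (C (psum ι ℂ (n - j))) +
        Polynomial.X * Polynomial.C (pairSum κ o (Polynomial.X ^ (n - j)))) * F j, ?_, ?_, ?_⟩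
    · refine Subalgebra.smul_mem _ (Subalgebra.sum_mem _ fun j hj => ?_) _
      rw [Finset.mem_range] at hj
      exact mul_mem (affine_mem_liftSubalgebra fun a => h𝒮 a (n - j) (by omega)) (hF j hj).1
    · rw [Polynomial.coeff_smul, Polynomial.finsetSum_coeff, neg_smul, hC]
      have h1 : ∀ j ∈ Finset.range n, ((Polynomial.C (C (psum ι ℂ (n - j))) +
          Polynomial.X * Polynomial.C (pairSum κ o (Polynomial.X ^ (n - j)))) * F j).coeff 0 =
          C (signedEsymm ι j * psum ι ℂ (n - j)) := fun j hj => by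
        rw [coeff_zero_affine_mul, (hF j (Finset.mem_range.1 hj)).2.1, C_mul, mul_comm]
      have h2 : ∑ j ∈ Finset.range n, signedEsymm ι j * psum ι ℂ (n - j) =
          -(C (n : ℂ) * signedEsymm ι n) := by rw [mul_signedEsymm, neg_neg]
      rw [Finset.sum_congr rfl h1, ← map_sum, h2, C_neg, C_mul]
      linear_combination (C (signedEsymm ι n)) * hcancel
    · rw [Polynomial.coeff_smul, Polynomial.finsetSum_coeff, neg_smul, hC]
      have h1 : ∀ j ∈ Finset.range n, ((Polynomial.C (C (psum ι ℂ (n - j))) +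
          Polynomial.X * Polynomial.C (pairSum κ o (Polynomial.X ^ (n - j)))) * F j).coeff 1 =
          pairSum κ o (Polynomial.C (signedEsymm ι j) * Polynomial.X ^ (n - j) -
            Polynomial.C (psum ι ℂ (n - j)) * rootPrimitive ι j) := fun j hj => by
        rw [coeff_one_affine_mul, (hF j (Finset.mem_range.1 hj)).2.1,
          (hF j (Finset.mem_range.1 hj)).2.2, map_sub, pairSum_C_mul, pairSum_C_mul]
        ring
      rw [Finset.sum_congr rfl h1, ← map_sum, ← mul_rootPrimitive, pairSum_C_mul, ← mul_assoc,
        hcancel, one_mul]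

lemma C_mem_limitSubalgebra
    (h𝒮 : ∀ a, ∀ i, 1 ≤ i → C (psum ι ℂ i) + a • pairSum κ o (Polynomial.X ^ i) ∈ 𝒮 a)
    {k : MvPolynomial ι ℂ} (hk : k.IsSymmetric) : C k ∈ limitSubalgebra 𝒮 := by
  obtain ⟨p, hp⟩ := esymmAlgHom_surjective (σ := ι) ℂ (le_refl (Fintype.card ι)) ⟨k, hk⟩
  have hp' := esymmAlgHom_apply (σ := ι) (R := ℂ) p
  rw [hp] at hp'
  dsimp only at hp'
  rw [hp']
  let T : Subalgebra ℂ (MvPolynomial ι ℂ) := (limitSubalgebra 𝒮).comap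
    (IsScalarTower.toAlgHom ℂ (MvPolynomial ι ℂ) (MvPolynomial κ (MvPolynomial ι ℂ)))
  change _ ∈ T
  have hle :
      Algebra.adjoin ℂ (Set.range fun i : Fin (Fintype.card ι) => esymm ι ℂ (i + 1)) ≤ T := by
    rw [Algebra.adjoin_le_iff]
    rintro _ ⟨i, rfl⟩
    obtain ⟨F, hF, hF0, -⟩ := exists_lift_signedEsymm h𝒮 (i + 1)
    have h1 : signedEsymm ι (i + 1) ∈ T := mem_limitSubalgebra.2 ⟨F, hF, hF0⟩
    have h2 := T.mul_mem (pow_mem (neg_mem (one_mem T)) (i + 1)) h1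
    rwa [signedEsymm, ← mul_assoc, ← mul_pow, neg_one_mul, neg_neg, one_pow, one_mul] at h2
  refine hle ?_
  rw [Algebra.adjoin_range_eq_range_aeval]
  exact ⟨p, rfl⟩

lemma pairSum_mem_limitSubalgebra
    (h𝒮 : ∀ a, ∀ i, 1 ≤ i → C (psum ι ℂ i) + a • pairSum κ o (Polynomial.X ^ i) ∈ 𝒮 a)
    {g : Polynomial (MvPolynomial ι ℂ)} (hg : HasSymmCoeffs g)
    (hd : rootPoly ι ∣ Polynomial.derivative g) : pairSum κ o g ∈ limitSubalgebra 𝒮 := by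
  obtain ⟨k, h, D, hk, hh, rfl⟩ := exists_sum_rootPrimitive hg hd
  rw [map_add, map_sum]
  refine add_mem ?_ (sum_mem fun n _ => ?_)
  · rw [pairSum_apply]
    simp only [Polynomial.eval_C, Polynomial.aeval_C]
    exact add_mem (C_mem_limitSubalgebra h𝒮 hk) (sum_mem fun _ _ => C_mem_limitSubalgebra h𝒮 hk)
  · rw [pairSum_C_mul]
    refine mul_mem (C_mem_limitSubalgebra h𝒮 (hh n)) ?_
    obtain ⟨F, hF, hF0, hF1⟩ := exists_lift_signedEsymm h𝒮 (Fintype.card ι + 1 + n)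
    rw [signedEsymm_eq_zero (by omega), C_0] at hF0
    have := coeff_one_mem_limitSubalgebra hF hF0
    rw [hF1] at this
    simpa using neg_mem this

end Recurrence

theorem IsQuasiInvariant.mem_limitSubalgebra {ι κ : Type*} [Fintype ι] [Fintype κ]
    [DecidableEq ι] [DecidableEq κ] {𝒮 : ℂ → Subalgebra ℂ (MvPolynomial κ (MvPolynomial ι ℂ))}
    {o l₀ : ι} {j₀ : κ}
    (h𝒮 : ∀ a, ∀ i, 1 ≤ i → C (psum ι ℂ i) + a • pairSum κ o (Polynomial.X ^ i) ∈ 𝒮 a)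
    (hl₀ : l₀ ≠ o) {f : MvPolynomial κ (MvPolynomial ι ℂ)} (hf : IsQuasiInvariant o l₀ j₀ f) :
    f ∈ limitSubalgebra 𝒮 :=
  hf.mem hl₀ (limitSubalgebra 𝒮).toSubring (fun _ hk => C_mem_limitSubalgebra h𝒮 hk)
    fun g hg hd => pairSum_apply (κ := κ) o g ▸ pairSum_mem_limitSubalgebra h𝒮 hg hd

section Substitution
variable {σ : Type*} [DecidableEq σ]

/-- Substitution of the variable `X j` for the variable `X i`. -/
noncomputable def substX (i j : σ) : MvPolynomial σ ℂ →ₐ[ℂ] MvPolynomial σ ℂ :=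
  aeval (Function.update X i (X j))

lemma substX_X_self (i j : σ) : substX i j (X i) = X j := by
  rw [substX, aeval_X, Function.update_self]

lemma substX_X_of_ne {i j k : σ} (h : k ≠ i) : substX i j (X k) = X k := by
  rw [substX, aeval_X, Function.update_of_ne h]

lemma eval_substX (i j : σ) (w : σ → ℂ) (f : MvPolynomial σ ℂ) :
    eval w (substX i j f) = eval (Function.update w i (w j)) f := by
  change ((aeval w : MvPolynomial σ ℂ →ₐ[ℂ] ℂ).comp (substX i j)) f =
    (aeval (Function.update w i (w j)) : MvPolynomial σ ℂ →ₐ[ℂ] ℂ) f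
  congr 1
  refine algHom_ext fun k => ?_
  rcases eq_or_ne k i with rfl | h
  · simp [substX_X_self]
  · simp [substX_X_of_ne h, h]

lemma rename_substX (τ : Equiv.Perm σ) (i j : σ) (f : MvPolynomial σ ℂ) :
    rename τ (substX i j f) = substX (τ i) (τ j) (rename τ f) := by
  change ((rename τ).comp (substX i j)) f = ((substX (τ i) (τ j)).comp (rename τ)) f
  congr 1
  refine algHom_ext fun k => ?_
  rcases eq_or_ne k i with rfl | h
  · simp [substX_X_self]
  · simp [substX_X_of_ne h, substX_X_of_ne (τ.injective.ne h)]

lemma substX_rename_swap (i j : σ) (f : MvPolynomial σ ℂ) :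
    substX i j (rename (Equiv.swap j i) f) = substX i j f := by
  change ((substX i j).comp (rename (Equiv.swap j i))) f = _
  congr 1
  refine algHom_ext fun k => ?_
  rcases eq_or_ne k i with rfl | h
  · rcases eq_or_ne k j with rfl | h'
    · simp
    · simp [substX_X_self, substX_X_of_ne h'.symm]
  · rcases eq_or_ne k j with rfl | h'
    · simp [substX_X_self, substX_X_of_ne h]
    · simp [Equiv.swap_apply_of_ne_of_ne h' h]

lemma sq_dvd_sub_rename_swap {i j : σ} (hij : i ≠ j) {f : MvPolynomial σ ℂ}
    (h : substX i j (pderiv i f - pderiv j f) = 0) :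
    (X j - X i) ^ 2 ∣ f - rename (Equiv.swap j i) f := by
  have h0 : X i - X j ∣ f - rename (Equiv.swap j i) f := by
    rw [X_sub_X_dvd_iff, ← substX, map_sub, substX_rename_swap, sub_self]
  obtain ⟨k, hk⟩ := h0
  have hj : pderiv j (rename (Equiv.swap j i) f) = rename (Equiv.swap j i) (pderiv i f) := by
    rw [← pderiv_rename (Equiv.injective _), Equiv.swap_apply_right]
  have hi : pderiv i (rename (Equiv.swap j i) f) = rename (Equiv.swap j i) (pderiv j f) := by
    rw [← pderiv_rename (Equiv.injective _), Equiv.swap_apply_left]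
  have h1 : substX i j (pderiv i (f - rename (Equiv.swap j i) f) -
      pderiv j (f - rename (Equiv.swap j i) f)) = 0 := by
    rw [map_sub] at h
    simp only [map_sub, hi, hj, substX_rename_swap]
    linear_combination 2 * h
  have h2 : pderiv i ((X i - X j) * k) - pderiv j ((X i - X j) * k) =
      2 * k + (X i - X j) * (pderiv i k - pderiv j k) := by
    simp only [Derivation.leibniz, map_sub, pderiv_X_self, pderiv_X_of_ne hij,
      pderiv_X_of_ne hij.symm, smul_eq_mul]
    ring
  rw [hk, h2, map_add, map_mul, map_mul, map_sub, substX_X_self, substX_X_of_ne hij.symm, sub_self,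
    zero_mul, add_zero, map_ofNat, mul_eq_zero, or_iff_right (by norm_num)] at h1
  rw [substX, ← X_sub_X_dvd_iff] at h1
  obtain ⟨m, rfl⟩ := h1
  exact ⟨m, by rw [hk]; ring⟩

end Substitution

section Homogeneous
variable {σ : Type*}

lemma homogeneousComponent_mem_adjoin {s : Set (MvPolynomial σ ℂ)}
    (hs : ∀ f ∈ s, ∃ n, f.IsHomogeneous n) {f : MvPolynomial σ ℂ} (hf : f ∈ Algebra.adjoin ℂ s)
    (k : ℕ) : homogeneousComponent k f ∈ Algebra.adjoin ℂ s := by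
  rw [← Subalgebra.mem_toSubmodule, Algebra.adjoin_eq_span] at hf
  induction hf using Submodule.span_induction with
  | mem x hx =>
    have h : ∃ n, x.IsHomogeneous n := by
      induction hx using Submonoid.closure_induction with
      | mem x hx => exact hs x hx
      | one => exact ⟨0, isHomogeneous_one σ ℂ⟩
      | mul x y _ _ hx hy =>
        obtain ⟨m, hm⟩ := hx
        obtain ⟨n, hn⟩ := hy
        exact ⟨m + n, hm.mul hn⟩
    obtain ⟨n, hn⟩ := h
    rw [homogeneousComponent_of_mem hn]
    split_ifs
    · exact Submonoid.closure_le (S := (Algebra.adjoin ℂ s).toSubmonoid).2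
        Algebra.subset_adjoin hx
    · exact zero_mem _
  | zero => rw [map_zero]; exact zero_mem _
  | add x y _ _ hx hy => rw [map_add]; exact add_mem hx hy
  | smul c x _ hx => rw [map_smul]; exact Subalgebra.smul_mem _ hx c

/-- The part of degree at most `d` of a polynomial. -/
noncomputable def truncation (d : ℕ) : MvPolynomial σ ℂ →ₗ[ℂ] MvPolynomial σ ℂ :=
  ∑ k ∈ Finset.range (d + 1), homogeneousComponent k

lemma truncation_apply (d : ℕ) (f : MvPolynomial σ ℂ) :
    truncation d f = ∑ k ∈ Finset.range (d + 1), homogeneousComponent k f := by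
  rw [truncation, LinearMap.sum_apply]

lemma totalDegree_truncation_le (d : ℕ) (f : MvPolynomial σ ℂ) :
    (truncation d f).totalDegree ≤ d := by
  rw [truncation_apply]
  refine totalDegree_finsetSum_le fun k hk => ?_
  exact (homogeneousComponent_isHomogeneous k f).totalDegree_le.trans
    (by rw [Finset.mem_range] at hk; omega)

lemma truncation_eq_self {d : ℕ} {f : MvPolynomial σ ℂ} (hf : f.totalDegree ≤ d) :
    truncation d f = f := by
  conv_rhs => rw [← sum_homogeneousComponent f]
  rw [truncation_apply]
  refine (Finset.sum_subset (Finset.range_mono (by omega)) fun k _ hk => ?_).symm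
  exact homogeneousComponent_eq_zero _ _ (by rw [Finset.mem_range] at hk; omega)

end Homogeneous

lemma isPolyCurve_eval {S W : Type*} [CommRing S] [Algebra ℂ S] [AddCommGroup W] [Module ℂ W]
    (F : Polynomial S) (φ : S →ₗ[ℂ] W) : IsPolyCurve fun a => φ (F.eval (algebraMap ℂ S a)) :=
  ⟨F.natDegree + 1, fun k => φ (F.coeff k), fun a => by
    simp only [Polynomial.eval_eq_sum_range, map_sum, ← map_smul, ← map_pow, Algebra.smul_def,
      mul_comm]⟩

/-- The elements of an algebra whose image under a derivation lies in the kernel of a morphism. -/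
def derivationKer {S T : Type*} [CommRing S] [CommRing T] [Algebra ℂ S] [Algebra ℂ T]
    (π : S →ₐ[ℂ] T) (D : Derivation ℂ S S) : Subalgebra ℂ S where
  carrier := {f | π (D f) = 0}
  mul_mem' {f g} hf hg := by
    rw [Set.mem_ofPred_eq] at *
    simp [hf, hg]
  add_mem' {f g} hf hg := by
    rw [Set.mem_ofPred_eq] at *
    simp [hf, hg]
  algebraMap_mem' c := by simp

section Conditions
variable {r s : ℕ}

/-- The evaluation at a point as a morphism of algebras. -/
noncomputable def evHom (xv : ℂ) (yv : Fin r → ℂ) (zv : Fin s → ℂ) : Rxrs r s →ₐ[ℂ] ℂ :=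
  aeval (Sum.elim (fun _ : Unit => xv) (Sum.elim yv zv))

lemma evHom_apply (xv : ℂ) (yv : Fin r → ℂ) (zv : Fin s → ℂ) (f : Rxrs r s) :
    evHom xv yv zv f = evP r s xv yv zv f := rfl

/-- The polynomials satisfying the conditions that do not involve the parameter. -/
noncomputable def baseSubalgebra (j : Fin r) (l : Fin s) : Subalgebra ℂ (Rxrs r s) :=
  (⨅ σ : Equiv.Perm (Fin r), AlgHom.equalizer (rename (Sum.map id (Sum.map σ id)))
      (AlgHom.id ℂ (Rxrs r s))) ⊓
    (⨅ τ : Equiv.Perm (Fin s), AlgHom.equalizer (rename (Sum.map id (Sum.map id τ)))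
      (AlgHom.id ℂ (Rxrs r s))) ⊓
    ⨅ p : ℂ × ℂ × (Fin r → ℂ) × (Fin s → ℂ), AlgHom.equalizer
      (evHom p.1 (Function.update p.2.2.1 j p.2.1) (Function.update p.2.2.2 l p.2.1))
      (evHom p.2.1 (Function.update p.2.2.1 j p.1) (Function.update p.2.2.2 l p.1))

lemma mem_baseSubalgebra {j : Fin r} {l : Fin s} {f : Rxrs r s} : f ∈ baseSubalgebra j l ↔
    (∀ σ : Equiv.Perm (Fin r), rename (Sum.map id (Sum.map σ id)) f = f) ∧
    (∀ τ : Equiv.Perm (Fin s), rename (Sum.map id (Sum.map id τ)) f = f) ∧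
    ∀ (xv u : ℂ) (yv : Fin r → ℂ) (zv : Fin s → ℂ),
      evP r s xv (Function.update yv j u) (Function.update zv l u) f =
        evP r s u (Function.update yv j xv) (Function.update zv l xv) f := by
  simp only [baseSubalgebra, Algebra.mem_inf, Algebra.mem_iInf, AlgHom.mem_equalizer,
    AlgHom.id_apply, evHom_apply, Prod.forall, and_assoc]

/-- The evaluation of a derivation at a point. -/
noncomputable def evDerivation (xv : ℂ) (yv : Fin r → ℂ) (zv : Fin s → ℂ)
    (D : Derivation ℂ (Rxrs r s) (Rxrs r s)) : Rxrs r s →ₗ[ℂ] ℂ :=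
  (evHom xv yv zv).toLinearMap ∘ₗ (D : Rxrs r s →ₗ[ℂ] Rxrs r s)

/-- The value at zero of the conditions that involve the parameter. -/
noncomputable def condConst (j : Fin r) (l : Fin s) :
    Rxrs r s →ₗ[ℂ] ℂ × ℂ × (Fin r → ℂ) × (Fin s → ℂ) → ℂ × ℂ × ℂ :=
  LinearMap.pi fun p =>
    (evDerivation p.1 (Function.update p.2.2.1 j p.2.1) (Function.update p.2.2.2 l p.2.1)
      (pderiv (Sum.inr (Sum.inl j)))).prod
    ((evDerivation p.1 (Function.update p.2.2.1 j p.1) p.2.2.2 (pderiv (Sum.inr (Sum.inl j)))).prod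
    (evDerivation p.1 p.2.2.1 (Function.update p.2.2.2 l p.1)
      (pderiv (Sum.inr (Sum.inr l)) - pderiv (Sum.inl ()))))

/-- The coefficient of the parameter in the conditions that involve it. -/
noncomputable def condLin (j : Fin r) (l : Fin s) :
    Rxrs r s →ₗ[ℂ] ℂ × ℂ × (Fin r → ℂ) × (Fin s → ℂ) → ℂ × ℂ × ℂ :=
  LinearMap.pi fun p =>
    (evDerivation p.1 (Function.update p.2.2.1 j p.2.1) (Function.update p.2.2.2 l p.2.1)
      (-pderiv (Sum.inr (Sum.inr l)))).prod
    ((evDerivation p.1 (Function.update p.2.2.1 j p.1) p.2.2.2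
      (pderiv (Sum.inr (Sum.inl j)) - pderiv (Sum.inl ()))).prod
    (evDerivation p.1 p.2.2.1 (Function.update p.2.2.2 l p.1) (pderiv (Sum.inr (Sum.inr l)))))

lemma evDerivation_add_smul (xv : ℂ) (yv : Fin r → ℂ) (zv : Fin s → ℂ) (a : ℂ)
    (D D' : Derivation ℂ (Rxrs r s) (Rxrs r s)) (f : Rxrs r s) :
    evDerivation xv yv zv D f + a • evDerivation xv yv zv D' f =
      evP r s xv yv zv ((D + a • D') f) := by
  rw [Derivation.add_apply, Derivation.smul_apply, ← evHom_apply, map_add, map_smul]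
  rfl

lemma cond_eq_zero_iff {j : Fin r} {l : Fin s} {a : ℂ} {f : Rxrs r s} :
    condConst j l f + a • condLin j l f = 0 ↔
      (∀ (xv u : ℂ) (yv : Fin r → ℂ) (zv : Fin s → ℂ),
        evP r s xv (Function.update yv j u) (Function.update zv l u)
          (pderiv (Sum.inr (Sum.inl j)) f - C a * pderiv (Sum.inr (Sum.inr l)) f) = 0) ∧
      (∀ (xv : ℂ) (yv : Fin r → ℂ) (zv : Fin s → ℂ),
        evP r s xv (Function.update yv j xv) zv
          (C (a + 1) * pderiv (Sum.inr (Sum.inl j)) f - C a * pderiv (Sum.inl ()) f) = 0) ∧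
      ∀ (xv : ℂ) (yv : Fin r → ℂ) (zv : Fin s → ℂ),
        evP r s xv yv (Function.update zv l xv)
          (C (a + 1) * pderiv (Sum.inr (Sum.inr l)) f - pderiv (Sum.inl ()) f) = 0 := by
  have h1 : pderiv (Sum.inr (Sum.inl j)) f - C a * pderiv (Sum.inr (Sum.inr l)) f =
      (pderiv (Sum.inr (Sum.inl j)) + a • -pderiv (Sum.inr (Sum.inr l)) :
        Derivation ℂ (Rxrs r s) (Rxrs r s)) f := by
    simp only [Derivation.add_apply, Derivation.smul_apply, Derivation.neg_apply, smul_eq_C_mul]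
    ring
  have h2 : C (a + 1) * pderiv (Sum.inr (Sum.inl j)) f - C a * pderiv (Sum.inl ()) f =
      (pderiv (Sum.inr (Sum.inl j)) + a • (pderiv (Sum.inr (Sum.inl j)) - pderiv (Sum.inl ())) :
        Derivation ℂ (Rxrs r s) (Rxrs r s)) f := by
    simp only [Derivation.add_apply, Derivation.smul_apply, Derivation.sub_apply, smul_eq_C_mul,
      C_add, C_1]
    ring
  have h3 : C (a + 1) * pderiv (Sum.inr (Sum.inr l)) f - pderiv (Sum.inl ()) f =
      (pderiv (Sum.inr (Sum.inr l)) - pderiv (Sum.inl ()) + a • pderiv (Sum.inr (Sum.inr l)) :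
        Derivation ℂ (Rxrs r s) (Rxrs r s)) f := by
    simp only [Derivation.add_apply, Derivation.smul_apply, Derivation.sub_apply, smul_eq_C_mul,
      C_add, C_1]
    ring
  simp only [h1, h2, h3, ← evDerivation_add_smul]
  constructor
  · intro h
    exact ⟨fun x u y z => congrArg Prod.fst (congrFun h (x, u, y, z)),
      fun x y z => congrArg (fun q => q.2.1) (congrFun h (x, 0, y, z)),
      fun x y z => congrArg (fun q => q.2.2) (congrFun h (x, 0, y, z))⟩
  · rintro ⟨h, h', h''⟩
    funext ⟨x, u, y, z⟩
    exact Prod.ext (h x u y z) (Prod.ext (h' x y z) (h'' x y z))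

lemma evP_Pa (a : ℂ) (i : ℕ) (xv : ℂ) (yv : Fin r → ℂ) (zv : Fin s → ℂ) :
    evP r s xv yv zv (Pa r s a i) = (a + 1) * xv ^ i + a * ∑ j, yv j ^ i + ∑ l, zv l ^ i := by
  simp [evP, Pa]

lemma sum_update_pow {n : ℕ} (v : Fin n → ℂ) (j : Fin n) (u : ℂ) (i : ℕ) :
    ∑ k, Function.update v j u k ^ i = u ^ i + ∑ k ∈ Finset.univ.erase j, v k ^ i := by
  rw [← Finset.add_sum_erase _ _ (Finset.mem_univ j), Function.update_self]
  congr 1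
  exact Finset.sum_congr rfl fun k hk => by rw [Function.update_of_ne (Finset.ne_of_mem_erase hk)]

lemma pderiv_Pa_inl (a : ℂ) (i : ℕ) : pderiv (Sum.inl ()) (Pa r s a i) =
    C (a + 1) * ((i : Rxrs r s) * X (Sum.inl ()) ^ (i - 1)) := by
  simp [Pa, pderiv_X]

lemma pderiv_Pa_inr_inl (a : ℂ) (i : ℕ) (j : Fin r) :
    pderiv (Sum.inr (Sum.inl j)) (Pa r s a i) =
      C a * ((i : Rxrs r s) * X (Sum.inr (Sum.inl j)) ^ (i - 1)) := by
  simp [Pa, pderiv_X, Pi.single_apply]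

lemma pderiv_Pa_inr_inr (a : ℂ) (i : ℕ) (l : Fin s) :
    pderiv (Sum.inr (Sum.inr l)) (Pa r s a i) =
      (i : Rxrs r s) * X (Sum.inr (Sum.inr l)) ^ (i - 1) := by
  simp [Pa, pderiv_X, Pi.single_apply]

lemma Ars_le_baseSubalgebra (a : ℂ) (j : Fin r) (l : Fin s) :
    Ars r s a ≤ baseSubalgebra j l := by
  refine Algebra.adjoin_le ?_
  rintro _ ⟨i, -, rfl⟩
  refine mem_baseSubalgebra.2 ⟨fun σ => ?_, fun τ => ?_, fun xv u yv zv => ?_⟩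
  · simp only [Pa, map_add, map_mul, map_pow, map_sum, rename_X, rename_C, Sum.map_inl, Sum.map_inr,
      id_eq]
    rw [Equiv.sum_comp σ fun k => (X (Sum.inr (Sum.inl k)) : Rxrs r s) ^ i]
  · simp only [Pa, map_add, map_mul, map_pow, map_sum, rename_X, rename_C, Sum.map_inl, Sum.map_inr,
      id_eq]
    rw [Equiv.sum_comp τ fun k => (X (Sum.inr (Sum.inr k)) : Rxrs r s) ^ i]
  · simp only [evP_Pa, sum_update_pow]
    ring

lemma cond_eq_zero_of_mem_Ars {a : ℂ} (j : Fin r) (l : Fin s) {f : Rxrs r s}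
    (hf : f ∈ Ars r s a) : condConst j l f + a • condLin j l f = 0 := by
  have key : ∀ (xv : ℂ) (yv : Fin r → ℂ) (zv : Fin s → ℂ) (D : Derivation ℂ (Rxrs r s) (Rxrs r s)),
      (∀ i, evP r s xv yv zv (D (Pa r s a i)) = 0) → evP r s xv yv zv (D f) = 0 := by
    intro xv yv zv D h
    have hle : Ars r s a ≤ derivationKer (evHom xv yv zv) D :=
      Algebra.adjoin_le (by rintro _ ⟨i, -, rfl⟩; exact h i)
    exact hle hf
  funext ⟨x, u, y, z⟩
  refine Prod.ext ((evDerivation_add_smul _ _ _ _ _ _ _).trans (key _ _ _ _ fun i => ?_))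
    (Prod.ext ((evDerivation_add_smul _ _ _ _ _ _ _).trans (key _ _ _ _ fun i => ?_))
    ((evDerivation_add_smul _ _ _ _ _ _ _).trans (key _ _ _ _ fun i => ?_)))
  all_goals
    simp only [Derivation.add_apply, Derivation.smul_apply, Derivation.sub_apply,
      Derivation.neg_apply, pderiv_Pa_inl, pderiv_Pa_inr_inl, pderiv_Pa_inr_inr, smul_eq_C_mul, evP,
      map_add, map_sub, map_neg, map_mul, map_pow, map_natCast, eval_C, eval_X, Sum.elim_inl,
      Sum.elim_inr, Function.update_self]
    ring

lemma isHomogeneous_Pa (a : ℂ) (i : ℕ) : (Pa r s a i).IsHomogeneous i := by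
  have hX : ∀ k : Unit ⊕ Fin r ⊕ Fin s, (X k ^ i : Rxrs r s).IsHomogeneous i := fun k =>
    isHomogeneous_X_pow k i
  refine ((hX _).C_mul _ |>.add ((IsHomogeneous.sum _ _ _ fun j _ => hX _).C_mul _)).add
    (IsHomogeneous.sum _ _ _ fun j _ => hX _)

lemma truncation_mem_Ars {a : ℂ} {f : Rxrs r s} (hf : f ∈ Ars r s a) (d : ℕ) :
    truncation d f ∈ Ars r s a := by
  rw [truncation_apply]
  refine sum_mem fun k _ => homogeneousComponent_mem_adjoin ?_ hf k
  rintro _ ⟨i, -, rfl⟩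
  exact ⟨i, isHomogeneous_Pa a i⟩

end Conditions

section Transport
variable {r s : ℕ}

/-- Regarding `x` and the `z`-variables as coefficients. -/
noncomputable def sumIso (r s : ℕ) :
    Rxrs r s ≃ₐ[ℂ] MvPolynomial (Fin r) (MvPolynomial (Unit ⊕ Fin s) ℂ) :=
  (renameEquiv ℂ ((Equiv.sumAssoc Unit (Fin r) (Fin s)).symm.trans
    ((Equiv.sumCongr (Equiv.sumComm _ _) (Equiv.refl _)).trans (Equiv.sumAssoc _ _ _)))).trans
  (sumAlgEquiv ℂ (Fin r) (Unit ⊕ Fin s))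

lemma sumIso_C (c : ℂ) : sumIso r s (C c) = C (C c) := by
  simp [sumIso]

lemma sumIso_X_inr_inl (j : Fin r) : sumIso r s (X (Sum.inr (Sum.inl j))) = X j := by
  simp [sumIso]

lemma sumIso_X_map (i : Unit ⊕ Fin s) : sumIso r s (X (Sum.map id Sum.inr i)) = C (X i) := by
  rcases i with i | i <;> simp [sumIso]

lemma sumIso_X_inl (u : Unit) : sumIso r s (X (Sum.inl u)) = C (X (Sum.inl u)) :=
  sumIso_X_map (Sum.inl u)

lemma sumIso_X_inr_inr (l : Fin s) : sumIso r s (X (Sum.inr (Sum.inr l))) = C (X (Sum.inr l)) :=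
  sumIso_X_map (Sum.inr l)

lemma sumIso_rename_left (σ : Equiv.Perm (Fin r)) (f : Rxrs r s) :
    sumIso r s (rename (Sum.map id (Sum.map σ id)) f) = rename σ (sumIso r s f) := by
  induction f using MvPolynomial.induction_on with
  | C c => simp [sumIso_C]
  | add p q hp hq => simp [hp, hq]
  | mul_X p i hp =>
    rw [map_mul, map_mul, map_mul, map_mul, hp]
    rcases i with ⟨⟩ | j | l <;> simp [sumIso_X_inl, sumIso_X_inr_inl, sumIso_X_inr_inr]

lemma sumIso_rename_right (τ : Equiv.Perm (Unit ⊕ Fin s)) (τ' : Equiv.Perm (Unit ⊕ Fin r ⊕ Fin s))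
    (h : ∀ j, τ' (Sum.inr (Sum.inl j)) = Sum.inr (Sum.inl j))
    (h' : ∀ i, τ' (Sum.map id Sum.inr i) = Sum.map id Sum.inr (τ i)) (f : Rxrs r s) :
    sumIso r s (rename τ' f) = coeffPerm (Fin r) τ (sumIso r s f) := by
  induction f using MvPolynomial.induction_on with
  | C c => simp [sumIso_C, coeffPerm]
  | add p q hp hq => simp [hp, hq]
  | mul_X p i hp =>
    rw [map_mul, map_mul, map_mul, map_mul, hp, rename_X]
    congr 1
    have key : ∀ i, sumIso r s (X (τ' (Sum.map id Sum.inr i))) =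
        coeffPerm (Fin r) τ (sumIso r s (X (Sum.map id Sum.inr i))) := fun i => by
      rw [h', sumIso_X_map, sumIso_X_map]
      simp [coeffPerm]
    rcases i with i | j | l
    · exact key (Sum.inl i)
    · rw [h, sumIso_X_inr_inl]
      simp [coeffPerm]
    · exact key (Sum.inr l)

lemma sumIso_pderiv (j : Fin r) (f : Rxrs r s) :
    sumIso r s (pderiv (Sum.inr (Sum.inl j)) f) = pderiv j (sumIso r s f) := by
  induction f using MvPolynomial.induction_on with
  | C c => simp [sumIso_C]
  | add p q hp hq => simp [hp, hq]
  | mul_X p i hp =>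
    rw [map_mul (sumIso r s) p, Derivation.leibniz, Derivation.leibniz, map_add, smul_eq_mul,
      smul_eq_mul, smul_eq_mul, smul_eq_mul, map_mul, map_mul, hp]
    congr 2
    rcases i with ⟨⟩ | j' | l
    · simp [sumIso_X_inl, pderiv_X]
    · rw [sumIso_X_inr_inl, pderiv_X, pderiv_X]
      rcases eq_or_ne j j' with rfl | h
      · simp
      · rw [Pi.single_eq_of_ne h.symm, Pi.single_eq_of_ne (by simpa using h.symm), map_zero]
    · simp [sumIso_X_inr_inr, pderiv_X]

lemma sumIso_substX (j : Fin r) (i : Unit ⊕ Fin s) (f : Rxrs r s) :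
    sumIso r s (substX (Sum.inr (Sum.inl j)) (Sum.map id Sum.inr i) f) =
      substC j (X i) (sumIso r s f) := by
  induction f using MvPolynomial.induction_on with
  | C c => simp [sumIso_C, substC, substX]
  | add p q hp hq => simp [hp, hq]
  | mul_X p k hp =>
    rw [map_mul, map_mul, map_mul, map_mul, hp]
    congr 1
    rcases k with ⟨⟩ | j' | l
    · rw [substX_X_of_ne (by simp), sumIso_X_inl]
      simp
    · rcases eq_or_ne j' j with rfl | h
      · rw [substX_X_self, sumIso_X_map, sumIso_X_inr_inl, substC, aeval_X, Function.update_self]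
      · rw [substX_X_of_ne (by simpa using h), sumIso_X_inr_inl, substC, aeval_X,
          Function.update_of_ne h]
    · rw [substX_X_of_ne (by simp), sumIso_X_inr_inr]
      simp

lemma sumIso_Pa (a : ℂ) (i : ℕ) : sumIso r s (Pa r s a i) =
    C (psum (Unit ⊕ Fin s) ℂ i) + a • pairSum (Fin r) (Sum.inl ()) (Polynomial.X ^ i) := by
  have ha : ∀ v : MvPolynomial (Fin r) (MvPolynomial (Unit ⊕ Fin s) ℂ), a • v = C (C a) * v :=
    fun v => by rw [Algebra.smul_def]; rfl
  rw [ha, pairSum_apply]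
  simp only [Pa, map_add, map_mul, map_sum, map_pow, sumIso_C, sumIso_X_inl, sumIso_X_inr_inl,
    sumIso_X_inr_inr, psum, Fintype.sum_sum_type, Polynomial.eval_pow, Polynomial.eval_X,
    Polynomial.aeval_X, map_one, Finset.univ_unique, Finset.sum_singleton]
  rw [show (default : Unit) = () from rfl]
  ring

lemma eval_update_inr_inl (w : Unit ⊕ Fin r ⊕ Fin s → ℂ) (j : Fin r) (u : ℂ) (f : Rxrs r s) :
    eval (Function.update w (Sum.inr (Sum.inl j)) u) f = evP r s (w (Sum.inl ()))
      (Function.update (fun k => w (Sum.inr (Sum.inl k))) j u)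
      (fun k => w (Sum.inr (Sum.inr k))) f := by
  rw [evP]
  congr 2
  funext i
  rcases i with ⟨⟩ | k | k
  · exact Function.update_of_ne (by simp) _ _
  · simp only [Function.update_apply, Sum.elim_inr, Sum.elim_inl, Sum.inr.injEq, Sum.inl.injEq]
  · exact Function.update_of_ne (by simp) _ _

lemma eval_update_inr_inr (w : Unit ⊕ Fin r ⊕ Fin s → ℂ) (l : Fin s) (u : ℂ) (f : Rxrs r s) :
    eval (Function.update w (Sum.inr (Sum.inr l)) u) f = evP r s (w (Sum.inl ()))
      (fun k => w (Sum.inr (Sum.inl k)))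
      (Function.update (fun k => w (Sum.inr (Sum.inr k))) l u) f := by
  rw [evP]
  congr 2
  funext i
  rcases i with ⟨⟩ | k | k
  · exact Function.update_of_ne (by simp) _ _
  · exact Function.update_of_ne (by simp) _ _
  · simp only [Function.update_apply, Sum.elim_inr, Sum.inr.injEq]

lemma rename_swap_substX {j : Fin r} {l : Fin s} {f : Rxrs r s} (hf : f ∈ baseSubalgebra j l) :
    rename (Equiv.swap (Sum.inl ()) (Sum.inr (Sum.inr l)))
      (substX (Sum.inr (Sum.inl j)) (Sum.inr (Sum.inr l)) f) =
      substX (Sum.inr (Sum.inl j)) (Sum.inr (Sum.inr l)) f := by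
  refine MvPolynomial.funext fun w => ?_
  rw [eval_rename, eval_substX, eval_substX, eval_update_inr_inl, eval_update_inr_inl]
  have h := (mem_baseSubalgebra.1 hf).2.2 (w (Sum.inl ())) (w (Sum.inr (Sum.inr l)))
    (fun k => w (Sum.inr (Sum.inl k))) (fun k => w (Sum.inr (Sum.inr k)))
  rw [Function.update_eq_self_iff.2 rfl] at h
  rw [h]
  simp only [Function.comp_apply, Equiv.swap_apply_left, Equiv.swap_apply_right]
  congr 1
  funext k
  rcases eq_or_ne k l with rfl | hk
  · rw [Equiv.swap_apply_right, Function.update_self]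
  · rw [Equiv.swap_apply_of_ne_of_ne (by simp) (by simpa using hk), Function.update_of_ne hk]

lemma substX_eq_zero {j : Fin r} {l : Fin s} {f : Rxrs r s} (hf : condConst j l f = 0) :
    substX (Sum.inr (Sum.inl j)) (Sum.inr (Sum.inr l)) (pderiv (Sum.inr (Sum.inl j)) f) = 0 ∧
    substX (Sum.inr (Sum.inl j)) (Sum.inl ()) (pderiv (Sum.inr (Sum.inl j)) f) = 0 ∧
    substX (Sum.inr (Sum.inr l)) (Sum.inl ())
      (pderiv (Sum.inr (Sum.inr l)) f - pderiv (Sum.inl ()) f) = 0 := by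
  have h0 : condConst j l f + (0 : ℂ) • condLin j l f = 0 := by rw [hf, zero_smul, add_zero]
  obtain ⟨h2, h3, h4⟩ := cond_eq_zero_iff.1 h0
  simp only [zero_add, C_0, C_1, zero_mul, one_mul, sub_zero] at h2 h3 h4
  refine ⟨?_, ?_, ?_⟩ <;> refine MvPolynomial.funext fun w => ?_
  · rw [map_zero, eval_substX, eval_update_inr_inl]
    convert h2 (w (Sum.inl ())) (w (Sum.inr (Sum.inr l))) (fun k => w (Sum.inr (Sum.inl k)))
      (fun k => w (Sum.inr (Sum.inr k))) using 2
    exact (Function.update_eq_self_iff.2 rfl).symm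
  · rw [map_zero, eval_substX, eval_update_inr_inl]
    exact h3 _ _ _
  · rw [map_zero, eval_substX, eval_update_inr_inr]
    exact h4 _ _ _

lemma swap_map_inr (l : Fin s) (i : Unit ⊕ Fin s) :
    Equiv.swap (Sum.inl ()) (Sum.inr (Sum.inr l)) (Sum.map id (Sum.inr : Fin s → Fin r ⊕ Fin s) i) =
      Sum.map id Sum.inr (Equiv.swap (Sum.inl ()) (Sum.inr l) i) := by
  have h : Function.Injective (Sum.map (id : Unit → Unit) (Sum.inr : Fin s → Fin r ⊕ Fin s)) :=
    Function.injective_id.sumMap Sum.inr_injective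
  exact (h.swap_apply (Sum.inl ()) (Sum.inr l) i)

lemma sumIso_rename_swap (l : Fin s) (f : Rxrs r s) :
    sumIso r s (rename (Equiv.swap (Sum.inl ()) (Sum.inr (Sum.inr l))) f) =
      coeffPerm (Fin r) (Equiv.swap (Sum.inl ()) (Sum.inr l)) (sumIso r s f) :=
  sumIso_rename_right _ _ (fun _ => Equiv.swap_apply_of_ne_of_ne (by simp) (by simp))
    (swap_map_inr l) f

theorem isQuasiInvariant_sumIso {j : Fin r} {l : Fin s} {f : Rxrs r s}
    (hf : f ∈ baseSubalgebra j l) (hf' : condConst j l f = 0) :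
    IsQuasiInvariant (Sum.inl ()) (Sum.inr l) j (sumIso r s f) := by
  obtain ⟨hy, hz, -⟩ := mem_baseSubalgebra.1 hf
  obtain ⟨h2, h3, h4⟩ := substX_eq_zero hf'
  let liftPerm (τ : Equiv.Perm (Fin s)) : Equiv.Perm (Unit ⊕ Fin r ⊕ Fin s) :=
    Equiv.sumCongr (Equiv.refl _) (Equiv.sumCongr (Equiv.refl _) τ)
  have hlift : ∀ τ, rename (liftPerm τ) f = f := hz
  have hl : ∀ m, liftPerm (Equiv.swap l m) (Sum.inr (Sum.inr l)) = Sum.inr (Sum.inr m) := by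
    intro m
    simp [liftPerm]
  refine ⟨fun σ => ?_, fun τ hτ => ?_, ?_, fun i => ?_, fun i hi => ?_⟩
  · rw [← sumIso_rename_left, hy]
  · obtain ⟨⟨σ, τ₂⟩, rfl⟩ := Equiv.Perm.mem_sumCongrHom_range_of_perm_mapsTo_inl (σ := τ) (by
      rintro _ ⟨⟨⟩, rfl⟩
      exact ⟨(), hτ.symm⟩)
    rw [← sumIso_rename_right _ (liftPerm τ₂) (fun _ => rfl) (by rintro (i | i) <;> rfl), hlift]
  · have h := sumIso_substX j (Sum.inr l) f
    rw [← h, ← sumIso_rename_swap]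
    exact congrArg _ (rename_swap_substX hf)
  · rw [← sumIso_pderiv, ← sumIso_substX]
    rcases i with ⟨⟩ | m
    · exact (congrArg _ h3).trans (map_zero _)
    · have h := congrArg (rename (liftPerm (Equiv.swap l m))) h2
      rw [rename_substX, ← pderiv_rename (Equiv.injective _), hlift, map_zero] at h
      rw [hl] at h
      exact (congrArg _ h).trans (map_zero _)
  · obtain ⟨m, rfl⟩ : ∃ m, i = Sum.inr m := by
      rcases i with ⟨⟩ | m
      · exact absurd rfl hi
      · exact ⟨m, rfl⟩
    have h := map_dvd (rename (liftPerm (Equiv.swap l m))) (sq_dvd_sub_rename_swap (by simp) h4)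
    have hc : liftPerm (Equiv.swap l m) ∘ Equiv.swap (Sum.inl ()) (Sum.inr (Sum.inr l)) =
        Equiv.swap (Sum.inl ()) (Sum.inr (Sum.inr m)) ∘ liftPerm (Equiv.swap l m) := by
      have := Equiv.mul_swap_eq_swap_mul (liftPerm (Equiv.swap l m)) (Sum.inl ())
        (Sum.inr (Sum.inr l))
      rw [hl] at this
      exact congrArg DFunLike.coe this
    rw [map_sub, rename_rename, hc, ← rename_rename, hlift, map_pow, map_sub, rename_X, rename_X,
      hl] at h
    have h' := map_dvd (sumIso r s) h
    rw [map_sub, map_pow, map_sub, sumIso_rename_swap, sumIso_X_inr_inr] at h'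
    rw [C_pow, C_sub, ← sumIso_X_inl]
    exact h'

end Transport

/-- A polynomial satisfying the conditions at `a = 0` is the limit of polynomials of bounded degree
in the algebras `Ars r s a`. -/
lemma exists_curve_of_mem_baseSubalgebra {r s : ℕ} {j : Fin r} {l : Fin s} {f : Rxrs r s}
    (hf : f ∈ baseSubalgebra j l) (hf' : condConst j l f = 0) {d : ℕ} (hd : f.totalDegree ≤ d) :
    ∃ c : ℂ → Rxrs r s, IsPolyCurve c ∧ c 0 = f ∧
      ∀ a ≠ 0, c a ∈ Ars r s a ∧ (c a).totalDegree ≤ d := by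
  have h𝒮 : ∀ a, ∀ i, 1 ≤ i → C (psum (Unit ⊕ Fin s) ℂ i) +
      a • pairSum (Fin r) (Sum.inl ()) (Polynomial.X ^ i) ∈
        (Ars r s a).map (sumIso r s : _ →ₐ[ℂ] _) := fun a i hi =>
    ⟨Pa r s a i, Algebra.subset_adjoin ⟨i, hi, rfl⟩, sumIso_Pa a i⟩
  obtain ⟨F, hF, hF0⟩ := mem_limitSubalgebra.1
    ((isQuasiInvariant_sumIso hf hf').mem_limitSubalgebra h𝒮 (by simp))
  refine ⟨_, isPolyCurve_eval F (truncation d ∘ₗ (sumIso r s).symm.toLinearMap), ?_,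
    fun a ha => ⟨?_, totalDegree_truncation_le _ _⟩⟩
  · rw [map_zero, ← Polynomial.coeff_zero_eq_eval_zero, hF0]
    exact (congrArg _ ((sumIso r s).symm_apply_apply f)).trans (truncation_eq_self hd)
  · obtain ⟨g, hg, hgF⟩ := mem_liftSubalgebra.1 hF a ha
    rw [← hgF]
    refine truncation_mem_Ars ?_ d
    exact ((sumIso r s).symm_apply_apply g).symm ▸ hg

lemma exists_countable_mem_Ars {r s : ℕ} (j : Fin r) (l : Fin s) :
    ∃ E : Set ℂ, E.Countable ∧ ∀ a ∉ E, ∀ f ∈ baseSubalgebra j l,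
      condConst j l f + a • condLin j l f = 0 → f ∈ Ars r s a := by
  have key : ∀ d : ℕ, ∃ E : Set ℂ, E.Countable ∧ ∀ a ∉ E,
      ∀ f ∈ (baseSubalgebra j l).toSubmodule ⊓ restrictTotalDegree _ ℂ d,
        condConst j l f + a • condLin j l f = 0 → f ∈ (Ars r s a).toSubmodule := fun d => by
    have : FiniteDimensional ℂ
        ↥((baseSubalgebra j l).toSubmodule ⊓ restrictTotalDegree (Unit ⊕ Fin r ⊕ Fin s) ℂ d) :=
      Submodule.finiteDimensional_of_le inf_le_right
    refine exists_countable_ker_le _ _ _ _ (fun a f hf => cond_eq_zero_of_mem_Ars j l hf) ?_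
    rintro f ⟨hf, hfd⟩ hf'
    obtain ⟨c, hc, hc0, hca⟩ := exists_curve_of_mem_baseSubalgebra hf hf'
      ((mem_restrictTotalDegree _ _ _).1 hfd)
    exact ⟨c, hc, hc0, fun a ha => ⟨(hca a ha).1, Ars_le_baseSubalgebra a j l (hca a ha).1,
      (mem_restrictTotalDegree _ _ _).2 (hca a ha).2⟩⟩
  choose E hE h using key
  refine ⟨⋃ d, E d, Set.countable_iUnion hE, fun a ha f hf hfa => ?_⟩
  exact h f.totalDegree a (fun h => ha (Set.mem_iUnion_of_mem _ h)) f
    ⟨hf, (mem_restrictTotalDegree _ _ _).2 le_rfl⟩ hfa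

end QuasiInvariants

/-- For `r, s ≥ 1` and all `a` outside some countable subset of `ℂ`, the algebra
`A_{r,s,a}` equals the algebra of all polynomials `f(x; y; z)` symmetric separately in the
`y`'s and in the `z`'s and satisfying the quasi-invariance conditions (1)–(4):
(1) `f(x; y_1,…,y_{r−1},u; z_1,…,z_{s−1},u) = f(u; y_1,…,y_{r−1},x; z_1,…,z_{s−1},x)`;
(2) `((∂_{y_r} − a ∂_{z_s}) f)(x; y_1,…,y_{r−1},u; z_1,…,z_{s−1},u) = 0`;
(3) `(((a+1)∂_{y_r} − a ∂_x) f)(x; y_1,…,y_{r−1},x; z_1,…,z_s) = 0`;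
(4) `(((a+1)∂_{z_s} − ∂_x) f)(x; y_1,…,y_r; z_1,…,z_{s−1},x) = 0`. -/
theorem Ars_eq_quasiinvariants (r s : ℕ) (hr : 1 ≤ r) (hs : 1 ≤ s) :
    ∃ E : Set ℂ, E.Countable ∧ ∀ a : ℂ, a ∉ E → ∀ f : Rxrs r s,
      f ∈ Ars r s a ↔
        ((∀ σ : Equiv.Perm (Fin r), rename (Sum.map id (Sum.map (⇑σ) id)) f = f) ∧
         (∀ τ : Equiv.Perm (Fin s), rename (Sum.map id (Sum.map id (⇑τ))) f = f) ∧
         (∀ (xv u : ℂ) (yv : Fin r → ℂ) (zv : Fin s → ℂ),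
            evP r s xv (Function.update yv ⟨r - 1, by omega⟩ u)
                (Function.update zv ⟨s - 1, by omega⟩ u) f =
            evP r s u (Function.update yv ⟨r - 1, by omega⟩ xv)
                (Function.update zv ⟨s - 1, by omega⟩ xv) f) ∧
         (∀ (xv u : ℂ) (yv : Fin r → ℂ) (zv : Fin s → ℂ),
            evP r s xv (Function.update yv ⟨r - 1, by omega⟩ u)
                (Function.update zv ⟨s - 1, by omega⟩ u)
              (pderiv (Sum.inr (Sum.inl ⟨r - 1, by omega⟩)) f -
                C a * pderiv (Sum.inr (Sum.inr ⟨s - 1, by omega⟩)) f) = 0) ∧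
         (∀ (xv : ℂ) (yv : Fin r → ℂ) (zv : Fin s → ℂ),
            evP r s xv (Function.update yv ⟨r - 1, by omega⟩ xv) zv
              (C (a + 1) * pderiv (Sum.inr (Sum.inl ⟨r - 1, by omega⟩)) f -
                C a * pderiv (Sum.inl ()) f) = 0) ∧
         (∀ (xv : ℂ) (yv : Fin r → ℂ) (zv : Fin s → ℂ),
            evP r s xv yv (Function.update zv ⟨s - 1, by omega⟩ xv)
              (C (a + 1) * pderiv (Sum.inr (Sum.inr ⟨s - 1, by omega⟩)) f -
                pderiv (Sum.inl ()) f) = 0)) := by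
  obtain ⟨E, hE, h⟩ := QuasiInvariants.exists_countable_mem_Ars
    (⟨r - 1, by omega⟩ : Fin r) (⟨s - 1, by omega⟩ : Fin s)
  refine ⟨E, hE, fun a ha f => ⟨fun hf => ?_, fun ⟨h1, h2, h3, h4⟩ =>
    h a ha f (QuasiInvariants.mem_baseSubalgebra.2 ⟨h1, h2, h3⟩)
      (QuasiInvariants.cond_eq_zero_iff.2 h4)⟩⟩
  obtain ⟨h1, h2, h3⟩ := QuasiInvariants.mem_baseSubalgebra.1
    (QuasiInvariants.Ars_le_baseSubalgebra a _ _ hf)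
  exact ⟨h1, h2, h3, QuasiInvariants.cond_eq_zero_iff.1
    (QuasiInvariants.cond_eq_zero_of_mem_Ars _ _ hf)⟩
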